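/- Let β ∈ {1,4}, and fix real parameters α > −1 and δ > −2 independent of n (corresponding to leads with m = n + C channels). For every odd integer l ≥ 1 and integer k ≥ 0 with (l,k) ≠ (1,0), the joint cumulants of conductance and shot noise satisfy lim_{n→∞} n^{l+k} · κ_{l,k}^{(β)}(n) = (δ/2 − α)(α + δ/2 + 2 − β) · (k+l−1)! / (β · (2β)^l · (4β)^k). -/

import Mathlib

open MeasureTheory Filter Finset

/-- The β-deformed Vandermonde interaction factor `∏_{j<k} |T_k - T_j|^β`. -/
noncomputable def vand (β : ℝ) {n : ℕ} (T : Fin n → ℝ) : ℝ :=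
  ∏ j, ∏ k ∈ Finset.Ioi j, |T k - T j| ^ β

/-- The Jacobi-ensemble weight `∏_j T_j^α (1-T_j)^{δ/2} ∏_{j<k} |T_k-T_j|^β`. -/
noncomputable def jacW (β α δ : ℝ) (n : ℕ) (T : Fin n → ℝ) : ℝ :=
  (∏ j, T j ^ α * (1 - T j) ^ (δ / 2)) * vand β T

/-- Selberg's integral `c_n^{(β)}`. -/
noncomputable def cSel (β α δ : ℝ) (n : ℕ) : ℝ :=
  ∫ T in Set.Icc (0 : Fin n → ℝ) 1, jacW β α δ n T

/-- The joint moment generating function `M_n^{(β)}(z,w)` of conductance and shot noise. -/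
noncomputable def Mjoint (β α δ : ℝ) (n : ℕ) (z w : ℝ) : ℝ :=
  (∫ T in Set.Icc (0 : Fin n → ℝ) 1,
      Real.exp (∑ j, (-(z * T j) - w * T j * (1 - T j))) * jacW β α δ n T) / cSel β α δ n

/-- The joint cumulant generating function `σ_n^{(β)}(z,w) = log M_n^{(β)}(z,w)`. -/
noncomputable def sigJoint (β α δ : ℝ) (n : ℕ) (z w : ℝ) : ℝ :=
  Real.log (Mjoint β α δ n z w)

/-- The joint cumulants `κ_{l,k}^{(β)}(n) = (-1)^{l+k} ∂_z^l ∂_w^k σ_n^{(β)}(0,0)`. -/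
noncomputable def kappaJ (β α δ : ℝ) (l k : ℕ) (n : ℕ) : ℝ :=
  (-1 : ℝ) ^ (l + k) *
    iteratedDeriv l (fun z => iteratedDeriv k (fun w => sigJoint β α δ n z w) 0) 0

/-- Binomial convolution of functions on multisets: the product of exponential generating
functions. -/
noncomputable def mconv (f g : Multiset ℕ → ℝ) (S : Multiset ℕ) : ℝ :=
  (S.antidiagonal.map fun p => f p.1 * g p.2).sum

/-- The shift `f ↦ f (l ::ₘ ·)`, the partial derivative of an exponential generating function. -/
def mshift (l : ℕ) (f : Multiset ℕ → ℝ) (S : Multiset ℕ) : ℝ := f (l ::ₘ S)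

lemma mconv_zero (f g : Multiset ℕ → ℝ) : mconv f g 0 = f 0 * g 0 := by
  simp [mconv]

lemma mconv_cons (f g : Multiset ℕ → ℝ) (l : ℕ) (S : Multiset ℕ) :
    mconv f g (l ::ₘ S) = mconv (mshift l f) g S + mconv f (mshift l g) S := by
  simp [mconv, mshift, Multiset.antidiagonal_cons, add_comm]

lemma mshift_mconv (f g : Multiset ℕ → ℝ) (l : ℕ) :
    mshift l (mconv f g) = mconv (mshift l f) g + mconv f (mshift l g) :=
  funext fun S => mconv_cons f g l S

lemma mconv_add_left (f₁ f₂ g : Multiset ℕ → ℝ) :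
    mconv (f₁ + f₂) g = mconv f₁ g + mconv f₂ g := by
  funext S; simp [mconv, add_mul]

lemma mconv_smul_left (c : ℝ) (f g : Multiset ℕ → ℝ) :
    mconv (c • f) g = c • mconv f g := by
  funext S; simp [mconv, mul_assoc, Multiset.sum_map_mul_left]

lemma mconv_comm (f g : Multiset ℕ → ℝ) : mconv f g = mconv g f := by
  funext S
  induction S using Multiset.induction generalizing f g with
  | empty => simp [mconv_zero, mul_comm]
  | cons a S ih => rw [mconv_cons, mconv_cons, ih, ih f, add_comm]

lemma mconv_add_right (f g₁ g₂ : Multiset ℕ → ℝ) :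
    mconv f (g₁ + g₂) = mconv f g₁ + mconv f g₂ := by
  rw [mconv_comm, mconv_add_left, mconv_comm g₁, mconv_comm g₂]

lemma mconv_smul_right (c : ℝ) (f g : Multiset ℕ → ℝ) :
    mconv f (c • g) = c • mconv f g := by
  rw [mconv_comm, mconv_smul_left, mconv_comm g]

lemma mconv_assoc (f g h : Multiset ℕ → ℝ) :
    mconv (mconv f g) h = mconv f (mconv g h) := by
  funext S
  induction S using Multiset.induction generalizing f g h with
  | empty => simp [mconv_zero, mul_assoc]
  | cons a S ih =>
    simp only [mconv_cons, mshift_mconv, mconv_add_left, mconv_add_right, Pi.add_apply, ih]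
    ring

/-- Convolution with a fixed right factor as a linear map. -/
noncomputable def mconvR (Z : Multiset ℕ → ℝ) : (Multiset ℕ → ℝ) →ₗ[ℝ] (Multiset ℕ → ℝ) where
  toFun f := mconv f Z
  map_add' f g := mconv_add_left f g Z
  map_smul' c f := mconv_smul_left c f Z

/-- The unit of the convolution. -/
noncomputable def mone (S : Multiset ℕ) : ℝ := if S = 0 then 1 else 0

lemma mshift_mone (l : ℕ) : mshift l mone = 0 := by
  funext S; simp [mshift, mone]

lemma mconvR_zero_left (g : Multiset ℕ → ℝ) : mconv 0 g = 0 := (mconvR g).map_zero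

lemma mone_mconv (f : Multiset ℕ → ℝ) : mconv mone f = f := by
  funext S
  induction S using Multiset.induction generalizing f with
  | empty => simp [mconv_zero, mone]
  | cons a S ih => rw [mconv_cons, mshift_mone, mconvR_zero_left, ih]; simp [mshift]

lemma antidiagonal_eq_cons (S : Multiset ℕ) :
    ∃ R : Multiset (Multiset ℕ × Multiset ℕ), S.antidiagonal = (S, 0) ::ₘ R ∧ ∀ p ∈ R, p.1 < S := by
  induction S using Multiset.induction with
  | empty => exact ⟨0, by simp, by simp⟩
  | cons a S ih =>
    obtain ⟨R, hR, hlt⟩ := ih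
    refine ⟨S.antidiagonal.map (Prod.map id (Multiset.cons a)) +
      R.map (Prod.map (Multiset.cons a) id), ?_, ?_⟩
    · rw [Multiset.antidiagonal_cons, hR]
      simp
    · intro p hp
      rw [Multiset.mem_add, Multiset.mem_map, Multiset.mem_map] at hp
      rcases hp with ⟨q, hq, rfl⟩ | ⟨q, hq, rfl⟩
      · have : q.1 ≤ S := by
          rw [Multiset.mem_antidiagonal] at hq
          rw [← hq]; exact Multiset.le_add_right _ _
        exact lt_of_le_of_lt this (Multiset.lt_cons_self _ _)
      · exact Multiset.cons_lt_cons _ (hlt q hq)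

/-- The part of the antidiagonal whose first component is a proper submultiset. -/
noncomputable def properAnti (S : Multiset ℕ) : Multiset (Multiset ℕ × Multiset ℕ) :=
  (antidiagonal_eq_cons S).choose

lemma antidiagonal_eq_cons_properAnti (S : Multiset ℕ) :
    S.antidiagonal = (S, 0) ::ₘ properAnti S := (antidiagonal_eq_cons S).choose_spec.1

lemma lt_of_mem_properAnti {S : Multiset ℕ} {p : Multiset ℕ × Multiset ℕ}
    (hp : p ∈ properAnti S) : p.1 < S := (antidiagonal_eq_cons S).choose_spec.2 p hp

lemma add_eq_of_mem_properAnti {S : Multiset ℕ} {p : Multiset ℕ × Multiset ℕ}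
    (hp : p ∈ properAnti S) : p.1 + p.2 = S := by
  rw [← Multiset.mem_antidiagonal, antidiagonal_eq_cons_properAnti]
  exact Multiset.mem_cons_of_mem hp

lemma mconv_eq_properAnti (f g : Multiset ℕ → ℝ) (S : Multiset ℕ) :
    mconv f g S = f S * g 0 + ((properAnti S).map fun p => f p.1 * g p.2).sum := by
  rw [mconv, antidiagonal_eq_cons_properAnti]
  simp

/-- The quotient `g / Z` with respect to convolution, for `Z 0 ≠ 0`. -/
noncomputable def mquo (Z g : Multiset ℕ → ℝ) (S : Multiset ℕ) : ℝ :=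
  (g S - ((properAnti S).attach.map fun p => mquo Z g p.1.1 * Z p.1.2).sum) / Z 0
termination_by S.card
decreasing_by exact Multiset.card_lt_card (lt_of_mem_properAnti p.2)

lemma mquo_eq (Z g : Multiset ℕ → ℝ) (S : Multiset ℕ) :
    mquo Z g S = (g S - ((properAnti S).map fun p => mquo Z g p.1 * Z p.2).sum) / Z 0 := by
  rw [mquo]
  rw [Multiset.attach_map_val' (properAnti S) (fun p => mquo Z g p.1 * Z p.2)]

lemma mquo_mconv {Z : Multiset ℕ → ℝ} (hZ : Z 0 ≠ 0) (g : Multiset ℕ → ℝ) :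
    mconv (mquo Z g) Z = g := by
  funext S
  rw [mconv_eq_properAnti, mquo_eq]
  field_simp
  ring

lemma mconv_right_cancel {Z f g : Multiset ℕ → ℝ} (hZ : Z 0 ≠ 0)
    (h : mconv f Z = mconv g Z) : f = g := by
  funext S
  induction S using Multiset.strongInductionOn with
  | _ S ih =>
    have h1 := congrFun h S
    rw [mconv_eq_properAnti, mconv_eq_properAnti] at h1
    have h2 : ((properAnti S).map fun p => f p.1 * Z p.2) =
        (properAnti S).map fun p => g p.1 * Z p.2 :=
      Multiset.map_congr rfl fun p hp => by rw [ih p.1 (lt_of_mem_properAnti hp)]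
    rw [h2] at h1
    exact mul_right_cancel₀ hZ (add_right_cancel h1)

/-- The sum over the elements `l` of a multiset of `F l` at the multiset with `l` erased. -/
noncomputable def msplit (F : ℕ → Multiset ℕ → ℝ) (S : Multiset ℕ) : ℝ :=
  (S.map fun l => F l (S.erase l)).sum

lemma msplit_zero (F : ℕ → Multiset ℕ → ℝ) : msplit F 0 = 0 := by simp [msplit]

lemma msplit_cons (F : ℕ → Multiset ℕ → ℝ) (r : ℕ) (S : Multiset ℕ) :
    msplit F (r ::ₘ S) = F r S + msplit (fun l => mshift r (F l)) S := by
  simp only [msplit, Multiset.map_cons, Multiset.sum_cons, Multiset.erase_cons_head, mshift]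
  congr 2
  refine Multiset.map_congr rfl fun l hl => ?_
  rw [Multiset.erase_cons_tail_of_mem hl]

lemma mshift_msplit (F : ℕ → Multiset ℕ → ℝ) (r : ℕ) :
    mshift r (msplit F) = F r + msplit (fun l => mshift r (F l)) :=
  funext fun S => msplit_cons F r S

lemma msplit_add (F G : ℕ → Multiset ℕ → ℝ) : msplit (F + G) = msplit F + msplit G := by
  funext S; simp [msplit]

lemma mconv_msplit (F : ℕ → Multiset ℕ → ℝ) (Z : Multiset ℕ → ℝ) :
    mconv (msplit F) Z = msplit (fun l => mconv (F l) Z) := by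
  funext S
  induction S using Multiset.induction generalizing F Z with
  | empty => simp [mconv_zero, msplit_zero]
  | cons a S ih =>
    have : (fun l => mconv (mshift a (F l)) Z + mconv (F l) (mshift a Z)) =
      (fun l => mconv (mshift a (F l)) Z) + fun l => mconv (F l) (mshift a Z) := rfl
    simp only [mconv_cons, msplit_cons, mshift_msplit, mconv_add_left, Pi.add_apply, ih,
      mshift_mconv]
    rw [this, msplit_add, Pi.add_apply]
    ring

/-- The indicator of the singleton multiset `{m}`. -/
noncomputable def msingle (m : ℕ) (S : Multiset ℕ) : ℝ := if S = {m} then 1 else 0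

lemma mshift_msingle (r m : ℕ) : mshift r (msingle m) = if r = m then mone else 0 := by
  funext S
  by_cases h : r = m
  · subst h
    have : (r ::ₘ S = {r}) ↔ S = 0 := Multiset.cons_inj_right r
    simp [mshift, msingle, mone, this]
  · have : r ::ₘ S ≠ {m} := fun hS => h (by
      have : r ∈ ({m} : Multiset ℕ) := hS ▸ Multiset.mem_cons_self r S
      simpa using this)
    simp [mshift, msingle, h, this]

lemma msingle_zero (m : ℕ) : msingle m 0 = 0 := by
  simp [msingle]

lemma msplit_ite_zero (m : ℕ) (f : Multiset ℕ → ℝ) :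
    mconv (msingle m) f = msplit (fun l => if l = m then f else 0) := by
  funext S
  induction S using Multiset.induction generalizing f with
  | empty => simp [mconv_zero, msplit_zero, msingle_zero]
  | cons a S ih =>
    rw [mconv_cons, msplit_cons, mshift_msingle, ih]
    congr 1
    · split_ifs
      · rw [mone_mconv]
      · rw [mconvR_zero_left]
    · congr 1
      funext l
      split_ifs <;> rfl

lemma msplit_finset_sum {ι : Type*} (s : Finset ι) (F : ι → ℕ → Multiset ℕ → ℝ) :
    msplit (∑ i ∈ s, F i) = ∑ i ∈ s, msplit (F i) := by
  classical
  induction s using Finset.induction with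
  | empty => funext S; simp [msplit]
  | insert a s ha ih => rw [Finset.sum_insert ha, Finset.sum_insert ha, msplit_add, ih]

lemma msplit_smul (c : ℝ) (F : ℕ → Multiset ℕ → ℝ) : msplit (c • F) = c • msplit F := by
  funext S; simp [msplit, Multiset.sum_map_mul_left]

lemma sum_smul_msingle_mconv (m : ℕ) (f : ℕ → Multiset ℕ → ℝ) :
    ∑ k ∈ Finset.Ico 1 m, (k : ℝ) • mconv (msingle k) (f (m - k)) =
      msplit (fun l => if l < m then (l : ℝ) • f (m - l) else 0) := by
  simp_rw [msplit_ite_zero, ← msplit_smul]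
  rw [← msplit_finset_sum]
  congr 1
  funext l S
  simp only [Finset.sum_apply, Pi.smul_apply, smul_eq_mul]
  have : ∀ k ∈ Finset.Ico 1 m, (k : ℝ) * (if l = k then f (m - k) else 0) S =
      if l = k then (l : ℝ) * f (m - l) S else 0 := by
    intro k _
    split_ifs with h
    · subst h; rfl
    · simp
  rw [Finset.sum_congr rfl this, Finset.sum_ite_eq]
  by_cases hl : l = 0
  · subst hl; simp
  · by_cases h : l < m
    · simp [h, Nat.one_le_iff_ne_zero.2 hl]
    · simp [h]

lemma msplit_msingle_cancel (m : ℕ) :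
    msplit (fun l => ((l : ℝ) * (m + l)) • msingle (m + l)) =
      msplit (fun l => if m < l then ((l : ℝ) * (l - m)) • msingle (l - m) else 0) := by
  funext S
  by_cases hS : S.card = 2
  · obtain ⟨a, b, rfl⟩ := Multiset.card_eq_two.1 hS
    have key : ∀ a b : ℕ, (((a : ℝ) * (m + a)) • msingle (m + a)) {b} =
        (if m < b then ((b : ℝ) * (b - m)) • msingle (b - m) else 0 : Multiset ℕ → ℝ) {a} := by
      intro a b
      by_cases h : b = m + a
      · subst h
        by_cases ha : a = 0
        · subst ha; simp
        · have : 0 < a := Nat.pos_of_ne_zero ha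
          simp [this, msingle]; ring
      · have h2 : m < b → a ≠ b - m := by omega
        split_ifs with h3
        · simp [msingle, h, h2 h3]
        · simp [msingle, h]
    have e2 : ({a, b} : Multiset ℕ).erase b = {a} := by
      rw [Multiset.pair_comm]; simp
    simp only [msplit, Multiset.insert_eq_cons, Multiset.map_cons, Multiset.map_singleton,
      Multiset.sum_cons, Multiset.sum_singleton, Multiset.erase_cons_head]
    rw [← Multiset.insert_eq_cons, e2, key a b, key b a, add_comm]
  · have h0 : ∀ l ∈ S, ∀ j, S.erase l ≠ {j} := by
      intro l hl j h
      have h1 := congrArg Multiset.card h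
      have h2 : 0 < S.card := Multiset.card_pos_iff_exists_mem.2 ⟨l, hl⟩
      rw [Multiset.card_erase_of_mem hl, Multiset.card_singleton, Nat.pred_eq_sub_one] at h1
      omega
    rw [msplit, msplit]
    congr 1
    refine Multiset.map_congr rfl fun l hl => ?_
    split_ifs
    · simp [msingle, h0 l hl]
    · simp [msingle, h0 l hl]

/-- The cumulant `κ(m, S)` attached to a moment sequence `Z`. -/
noncomputable def mcum (Z : Multiset ℕ → ℝ) (m : ℕ) : Multiset ℕ → ℝ := mquo Z (mshift m Z)

lemma mcum_mconv {Z : Multiset ℕ → ℝ} (hZ : Z 0 ≠ 0) (m : ℕ) :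
    mconv (mcum Z m) Z = mshift m Z := mquo_mconv hZ _

lemma mshift_mshift_eq {Z : Multiset ℕ → ℝ} (hZ : Z 0 ≠ 0) (j k : ℕ) :
    mshift j (mshift k Z) =
      mconv (mshift j (mcum Z k) + mconv (mcum Z k) (mcum Z j)) Z := by
  rw [← mcum_mconv hZ k, mshift_mconv, mconv_add_left, ← mcum_mconv hZ j, mconv_assoc]

/-- The parity-dependent edge coefficient. -/
noncomputable def gpar (p q : ℝ) (r : ℕ) : ℝ := p + (-1) ^ r * q

/-- The coefficient of `X_m` in the one-body part of the loop equation. -/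
noncomputable def cdiag (β p q : ℝ) (m : ℕ) : ℝ := (2 - β) * m / 4 + (p + q) / 2

/-- The loop equations satisfied by the moments of the Jacobi ensemble. -/
structure MomentLoop (β p q N : ℝ) (Z : Multiset ℕ → ℝ) : Prop where
  ne_zero : Z 0 ≠ 0
  shift_zero : mshift 0 Z = (2 * N) • Z
  loop : ∀ m : ℕ, 1 ≤ m →
    (β * N / 2 + cdiag β p q m) • mshift m Z +
      (β / 4) • ∑ k ∈ Finset.Ico 1 m, mshift (m - k) (mshift k Z) +
      ∑ k ∈ Finset.Ico 1 m, gpar p q k • mshift (m - k) Z + (N * gpar p q m) • Z +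
      msplit (fun l => ((l : ℝ) / 2) • (mshift (m + l) Z - mshift ((m : ℤ) - l).natAbs Z)) = 0

lemma MomentLoop.mcum_zero {β p q N : ℝ} {Z : Multiset ℕ → ℝ} (h : MomentLoop β p q N Z) :
    mcum Z 0 = (2 * N) • mone := by
  apply mconv_right_cancel h.ne_zero
  rw [mcum_mconv h.ne_zero, h.shift_zero, mconv_smul_left, mone_mconv]

lemma MomentLoop.mcum_loop {β p q N : ℝ} {Z : Multiset ℕ → ℝ} (h : MomentLoop β p q N Z)
    {m : ℕ} (hm : 1 ≤ m) :
    (β * N / 2 + cdiag β p q m) • mcum Z m +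
      (β / 4) • ∑ k ∈ Finset.Ico 1 m,
        (mshift (m - k) (mcum Z k) + mconv (mcum Z k) (mcum Z (m - k))) +
      ∑ k ∈ Finset.Ico 1 m, gpar p q k • mcum Z (m - k) + (N * gpar p q m) • mone +
      msplit (fun l => ((l : ℝ) / 2) • (mcum Z (m + l) - mcum Z ((m : ℤ) - l).natAbs)) = 0 := by
  apply mconv_right_cancel h.ne_zero
  rw [mconvR_zero_left, ← h.loop m hm]
  have hR : ∀ j, mconvR Z (mcum Z j) = mshift j Z := fun j => mcum_mconv h.ne_zero j
  have hR2 : ∀ j k, mconvR Z (mshift j (mcum Z k) + mconv (mcum Z k) (mcum Z j)) =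
      mshift j (mshift k Z) := fun j k => (mshift_mshift_eq h.ne_zero j k).symm
  have hR3 : mconvR Z mone = Z := mone_mconv Z
  have hR4 : ∀ F, mconvR Z (msplit F) = msplit (fun l => mconvR Z (F l)) :=
    fun F => mconv_msplit F Z
  change mconvR Z _ = _
  rw [map_add, map_add, map_add, map_add, map_smul, map_smul, map_smul, map_sum, map_sum, hR, hR3,
    hR4]
  simp only [map_smul, map_sub, hR, hR2]

/-- The leading part of the cumulants: a mean and a diagonal covariance. -/
noncomputable def clead (β p q : ℝ) (m : ℕ) : Multiset ℕ → ℝ :=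
  (-(2 / β) * gpar p q m) • mone + (2 * m / β) • msingle m

/-- The cumulants after subtraction of their leading part. -/
noncomputable def crem (β p q : ℝ) (Z : Multiset ℕ → ℝ) (m : ℕ) : Multiset ℕ → ℝ :=
  mcum Z m - clead β p q m

/-- The sign of `m - l`, as a real number. -/
def sgnSub (m l : ℕ) : ℝ := if l < m then 1 else if m < l then -1 else 0

/-- The inhomogeneous term of the loop equation for the subtracted cumulants. -/
noncomputable def cres (β p q : ℝ) (m : ℕ) : Multiset ℕ → ℝ :=
  (-(1 / β) * (∑ k ∈ Finset.Ico 1 m, gpar p q k * gpar p q (m - k)) -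
    2 / β * cdiag β p q m * gpar p q m +
    β / 4 * ∑ k ∈ Finset.Ico 1 m, if m - k = k then 2 * (k : ℝ) / β else 0) • mone +
  (2 * m / β * cdiag β p q m - m / β * gpar p q (m + m)) • msingle m

lemma sum_Ico_reflect' {M : Type*} [AddCommMonoid M] (m : ℕ) (f : ℕ → ℕ → M) :
    ∑ k ∈ Finset.Ico 1 m, f k (m - k) = ∑ k ∈ Finset.Ico 1 m, f (m - k) k := by
  refine Finset.sum_nbij' (fun k => m - k) (fun k => m - k) ?_ ?_ ?_ ?_ ?_
  · intro k hk; simp only [Finset.mem_Ico] at *; omega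
  · intro k hk; simp only [Finset.mem_Ico] at *; omega
  · intro k hk; simp only [Finset.mem_Ico] at *; omega
  · intro k hk; simp only [Finset.mem_Ico] at *; omega
  · intro k hk
    simp only [Finset.mem_Ico] at hk
    rw [Nat.sub_sub_self (by omega)]

lemma mshift_clead (β p q : ℝ) (r m : ℕ) :
    mshift r (clead β p q m) = (if r = m then 2 * (m : ℝ) / β else 0) • mone := by
  have h1 := mshift_mone r
  have h2 := mshift_msingle r m
  funext S
  have h1 := congrFun h1 S
  have h2 := congrFun h2 S
  simp only [mshift] at h1 h2
  simp only [mshift, clead, Pi.add_apply, Pi.smul_apply, smul_eq_mul, h1, h2]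
  split_ifs <;> simp

lemma clead_mconv (β p q : ℝ) (m : ℕ) (f : Multiset ℕ → ℝ) :
    mconv (clead β p q m) f =
      (-(2 / β) * gpar p q m) • f + (2 * m / β) • mconv (msingle m) f := by
  rw [clead, mconv_add_left, mconv_smul_left, mconv_smul_left, mone_mconv]

lemma gpar_natAbs (p q : ℝ) (m l : ℕ) : gpar p q ((m : ℤ) - l).natAbs = gpar p q (m + l) := by
  have : Even ((m : ℤ) - l).natAbs ↔ Even (m + l) := by
    rw [Int.natAbs_even, Int.even_sub, Nat.even_add, Int.even_coe_nat, Int.even_coe_nat]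
  rw [gpar, gpar]
  by_cases h : Even (m + l)
  · rw [h.neg_one_pow, (this.2 h).neg_one_pow]
  · rw [(Nat.not_even_iff_odd.1 h).neg_one_pow,
      (Nat.not_even_iff_odd.1 (fun h' => h (this.1 h'))).neg_one_pow]

lemma gpar_sub (p q : ℝ) {m l : ℕ} (h : l ≤ m) : gpar p q (m - l) = gpar p q (m + l) := by
  rw [← gpar_natAbs]; congr; omega

lemma MomentLoop.crem_loop {β p q N : ℝ} (hβ : β ≠ 0) {Z : Multiset ℕ → ℝ}
    (h : MomentLoop β p q N Z) {m : ℕ} (hm : 1 ≤ m) :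
    (β * N / 2 + cdiag β p q m) • crem β p q Z m +
      (β / 4) • ∑ k ∈ Finset.Ico 1 m,
        (mshift (m - k) (crem β p q Z k) + mconv (crem β p q Z k) (crem β p q Z (m - k))) +
      msplit (fun l => ((l : ℝ) / 2) • (crem β p q Z (m + l) +
        sgnSub m l • crem β p q Z ((m : ℤ) - l).natAbs)) + cres β p q m = 0 := by
  have hloop := h.mcum_loop hm
  have hz := h.mcum_zero
  set κ := mcum Z with hκ
  set u := crem β p q Z with hu
  have hκu : ∀ j, κ j = clead β p q j + u j := fun j => by simp [hu, crem, hκ]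
  -- the quadratic term
  have hquad : ∑ k ∈ Finset.Ico 1 m, mconv (κ k) (κ (m - k)) =
      -(2 / β) • ∑ k ∈ Finset.Ico 1 m, gpar p q k • (κ (m - k) + u (m - k)) +
      (2 / β) • msplit (fun l => if l < m then (l : ℝ) • (κ (m - l) + u (m - l)) else 0) +
      ∑ k ∈ Finset.Ico 1 m, mconv (u k) (u (m - k)) := by
    have h1 : ∑ k ∈ Finset.Ico 1 m, mconv (u k) (clead β p q (m - k)) =
        ∑ k ∈ Finset.Ico 1 m, mconv (clead β p q k) (u (m - k)) := by
      rw [sum_Ico_reflect' m (fun i j => mconv (u i) (clead β p q j))]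
      exact Finset.sum_congr rfl fun k _ => mconv_comm _ _
    have h2 : ∀ k ∈ Finset.Ico 1 m, mconv (κ k) (κ (m - k)) =
        mconv (clead β p q k) (κ (m - k)) + mconv (u k) (clead β p q (m - k)) +
          mconv (u k) (u (m - k)) := by
      intro k _
      rw [hκu k, mconv_add_left]
      rw [add_assoc, ← mconv_add_right (u k), ← hκu]
    rw [Finset.sum_congr rfl h2, Finset.sum_add_distrib, Finset.sum_add_distrib, h1,
      ← sum_smul_msingle_mconv m (fun j => κ j + u j)]
    simp only [Finset.smul_sum, ← Finset.sum_add_distrib]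
    refine Finset.sum_congr rfl fun k _ => ?_
    simp only [clead_mconv, mconv_add_right]
    module
  have hlin : ∑ k ∈ Finset.Ico 1 m, gpar p q k • (κ (m - k) + u (m - k)) =
      (2 : ℝ) • ∑ k ∈ Finset.Ico 1 m, gpar p q k • κ (m - k) -
      ((-(2 / β) * ∑ k ∈ Finset.Ico 1 m, gpar p q k * gpar p q (m - k)) • mone +
      (2 / β) • msplit (fun l => if l < m then (l : ℝ) • (gpar p q (m - l) • mone) else 0)) := by
    rw [← sum_smul_msingle_mconv m (fun j => gpar p q j • mone),
      sum_Ico_reflect' m (fun i j => (i : ℝ) • mconv (msingle i) (gpar p q j • mone))]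
    rw [Finset.smul_sum, Finset.smul_sum, Finset.mul_sum, Finset.sum_smul,
      ← Finset.sum_add_distrib, ← Finset.sum_sub_distrib]
    refine Finset.sum_congr rfl fun k _ => ?_
    rw [hκu (m - k), clead, mconv_smul_right, mconv_comm, mone_mconv]
    module
  have hshift : ∑ k ∈ Finset.Ico 1 m, mshift (m - k) (κ k) =
      (∑ k ∈ Finset.Ico 1 m, if m - k = k then 2 * (k : ℝ) / β else 0) • mone +
      ∑ k ∈ Finset.Ico 1 m, mshift (m - k) (u k) := by
    rw [Finset.sum_smul, ← Finset.sum_add_distrib]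
    refine Finset.sum_congr rfl fun k _ => ?_
    rw [← mshift_clead β p q, hκu k]
    rfl
  -- the split terms
  have hsp : msplit (fun l => ((l : ℝ) / 2) • (κ (m + l) - κ ((m : ℤ) - l).natAbs)) +
      (1 / 2 : ℝ) • msplit (fun l => if l < m then (l : ℝ) • (κ (m - l) + u (m - l)) else 0) +
      (1 / β) • msplit (fun l => if l < m then (l : ℝ) • (gpar p q (m - l) • mone) else 0) =
      msplit (fun l => ((l : ℝ) / 2) • (u (m + l) + sgnSub m l • u ((m : ℤ) - l).natAbs)) +
      (1 / β) • msplit (fun l => ((l : ℝ) * (m + l)) • msingle (m + l)) +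
      (-(1 / β)) • msplit
        (fun l => if m < l then ((l : ℝ) * (l - m)) • msingle (l - m) else 0) +
      (-(m / β) * gpar p q (m + m) - m * N) • msplit (fun l => if l = m then mone else 0) := by
    simp only [← msplit_smul, ← msplit_add]
    congr 1
    funext l
    simp only [Pi.add_apply, Pi.smul_apply]
    rcases lt_trichotomy l m with hl | hl | hl
    · have e : ((m : ℤ) - l).natAbs = m - l := by omega
      have hg := gpar_sub p q hl.le
      rw [e, hκu (m + l), hκu (m - l), clead, clead, hg]
      simp only [hl, hl.ne, not_lt.2 hl.le, if_true, if_false, sgnSub]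
      push_cast
      module
    · subst hl
      simp only [sub_self, Int.natAbs_zero, hz, hκu (l + l), clead, lt_irrefl, if_false, if_true,
        sgnSub]
      push_cast
      module
    · have e : ((m : ℤ) - l).natAbs = l - m := by omega
      have hg := gpar_sub p q hl.le
      rw [e, hκu (m + l), hκu (l - m), clead, clead, hg, add_comm l m]
      simp only [hl, hl.ne', not_lt.2 hl.le, if_true, if_false, sgnSub]
      push_cast [Nat.cast_sub hl.le]
      module
  rw [msplit_msingle_cancel, ← msplit_ite_zero, mconv_comm, mone_mconv] at hsp
  rw [Finset.sum_add_distrib, hquad, hlin, hshift, hκu m] at hloop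
  rw [Finset.sum_add_distrib, cres]
  rw [eq_sub_of_add_eq (eq_sub_of_add_eq hsp)] at hloop
  rw [clead] at hloop
  rw [← hloop]
  match_scalars <;> field_simp <;> ring

/-- The sequence `f` is `O(n ^ e)`. -/
def PowO (f : ℕ → ℝ) (e : ℤ) : Prop := f =O[atTop] fun n : ℕ => (n : ℝ) ^ e

lemma PowO.mono {f : ℕ → ℝ} {e e' : ℤ} (h : PowO f e) (he : e ≤ e') : PowO f e' := by
  refine h.trans (Asymptotics.IsBigO.of_bound 1 ?_)
  filter_upwards [eventually_ge_atTop 1] with n hn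
  have hn' : (1 : ℝ) ≤ n := by exact_mod_cast hn
  rw [one_mul, Real.norm_of_nonneg (by positivity), Real.norm_of_nonneg (by positivity)]
  exact zpow_le_zpow_right₀ hn' he

lemma PowO.add {f g : ℕ → ℝ} {e : ℤ} (hf : PowO f e) (hg : PowO g e) :
    PowO (fun n => f n + g n) e := Asymptotics.IsBigO.add hf hg

lemma PowO.neg {f : ℕ → ℝ} {e : ℤ} (hf : PowO f e) : PowO (fun n => - f n) e :=
  Asymptotics.IsBigO.neg_left hf

lemma PowO.sub {f g : ℕ → ℝ} {e : ℤ} (hf : PowO f e) (hg : PowO g e) :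
    PowO (fun n => f n - g n) e := Asymptotics.IsBigO.sub hf hg

lemma PowO.const_mul {f : ℕ → ℝ} {e : ℤ} (c : ℝ) (hf : PowO f e) :
    PowO (fun n => c * f n) e := Asymptotics.IsBigO.const_mul_left hf c

lemma PowO.congr {f g : ℕ → ℝ} {e : ℤ} (hf : PowO f e) (h : ∀ n : ℕ, 1 ≤ n → f n = g n) :
    PowO g e := by
  have h' : f =ᶠ[atTop] g := (eventually_ge_atTop 1).mono h
  exact Asymptotics.IsBigO.congr' hf h' (Filter.EventuallyEq.refl _ _)

lemma PowO.mul {f g : ℕ → ℝ} {e e' : ℤ} (hf : PowO f e) (hg : PowO g e') :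
    PowO (fun n => f n * g n) (e + e') := by
  refine (Asymptotics.IsBigO.mul hf hg).congr' (Filter.EventuallyEq.refl _ _) ?_
  filter_upwards [eventually_ge_atTop 1] with n hn
  have hn' : (n : ℝ) ≠ 0 := by positivity
  rw [zpow_add₀ hn']

lemma powO_const (c : ℝ) : PowO (fun _ => c) 0 := by
  simpa [PowO] using Asymptotics.isBigO_const_const c (one_ne_zero (α := ℝ)) (atTop (α := ℕ))

lemma powO_zero (e : ℤ) : PowO (fun _ => 0) e := Asymptotics.isBigO_zero _ _

lemma powO_zpow (e : ℤ) : PowO (fun n => (n : ℝ) ^ e) e := Asymptotics.isBigO_refl _ _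

lemma PowO.multiset_sum {ι : Type*} {s : Multiset ι} {f : ι → ℕ → ℝ} {e : ℤ}
    (h : ∀ i ∈ s, PowO (f i) e) : PowO (fun n => (s.map fun i => f i n).sum) e := by
  induction s using Multiset.induction with
  | empty => simpa using powO_zero e
  | cons a s ih =>
    simp only [Multiset.map_cons, Multiset.sum_cons]
    exact (h a (Multiset.mem_cons_self a s)).add
      (ih fun i hi => h i (Multiset.mem_cons_of_mem hi))

lemma PowO.finset_sum {ι : Type*} {s : Finset ι} {f : ι → ℕ → ℝ} {e : ℤ}
    (h : ∀ i ∈ s, PowO (f i) e) : PowO (fun n => ∑ i ∈ s, f i n) e :=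
  PowO.multiset_sum (s := s.1) h

lemma PowO.of_mul_self {f : ℕ → ℝ} {c : ℝ} (hc : c ≠ 0) {e : ℤ}
    (h : PowO (fun n => c * n * f n) (1 + e)) : PowO f e := by
  have h1 := ((powO_zpow (-1)).mul h).const_mul c⁻¹
  rw [show -1 + (1 + e) = e by ring] at h1
  refine h1.congr fun n hn => ?_
  have hn' : (n : ℝ) ≠ 0 := by positivity
  rw [zpow_neg_one]
  field_simp

/-- The elements of a multiset are positive. -/
def MPos (S : Multiset ℕ) : Prop := ∀ l ∈ S, 1 ≤ l

lemma MPos.cons {S : Multiset ℕ} (h : MPos S) {l : ℕ} (hl : 1 ≤ l) : MPos (l ::ₘ S) := by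
  intro j hj
  rcases Multiset.mem_cons.1 hj with rfl | hj
  · exact hl
  · exact h j hj

lemma MPos.mono {S T : Multiset ℕ} (h : MPos S) (hT : T ≤ S) : MPos T :=
  fun l hl => h l (Multiset.mem_of_le hT hl)

lemma MPos.card_le_sum {S : Multiset ℕ} (h : MPos S) : S.card ≤ S.sum := by
  have := Multiset.card_nsmul_le_sum (s := S) (a := 1) h
  simpa using this

lemma sum_erase_add {S : Multiset ℕ} {l : ℕ} (hl : l ∈ S) : (S.erase l).sum + l = S.sum := by
  conv_rhs => rw [← Multiset.cons_erase hl]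
  rw [Multiset.sum_cons, add_comm]

lemma card_erase_add {S : Multiset ℕ} {l : ℕ} (hl : l ∈ S) : (S.erase l).card + 1 = S.card := by
  conv_rhs => rw [← Multiset.cons_erase hl]
  rw [Multiset.card_cons]

lemma powO_mcum {Z : ℕ → Multiset ℕ → ℝ} (h0 : ∀ n, Z n 0 ≠ 0)
    (hZ : ∀ n S, |Z n S| ≤ (2 * n) ^ S.card * Z n 0) (m : ℕ) (S : Multiset ℕ) :
    PowO (fun n => mcum (Z n) m S) (1 + S.card) := by
  have hq : ∀ S, PowO (fun n => Z n S / Z n 0) S.card := by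
    intro S
    refine Asymptotics.IsBigO.of_bound (2 ^ S.card) (Eventually.of_forall fun n => ?_)
    have hpos : 0 < Z n 0 := by
      have := (abs_nonneg _).trans (hZ n 0)
      simp only [Multiset.card_zero, pow_zero, one_mul] at this
      exact lt_of_le_of_ne this (h0 n).symm
    rw [Real.norm_eq_abs, abs_div, abs_of_pos hpos, div_le_iff₀ hpos,
      Real.norm_of_nonneg (by positivity), zpow_natCast, ← mul_pow]
    exact hZ n S
  induction S using Multiset.strongInductionOn with
  | _ S ih =>
    have e1 := hq (m ::ₘ S)
    have e2 : PowO (fun n => ((properAnti S).map fun p =>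
        mcum (Z n) m p.1 * (Z n p.2 / Z n 0)).sum) (1 + S.card) := by
      refine PowO.multiset_sum (f := fun (p : Multiset ℕ × Multiset ℕ) n => mcum (Z n) m p.1 * (Z n p.2 / Z n 0))
        fun p hp => ?_
      refine ((ih p.1 (lt_of_mem_properAnti hp)).mul (hq p.2)).mono ?_
      rw [← add_eq_of_mem_properAnti hp, Multiset.card_add]
      push_cast
      linarith
    refine ((e1.mono ?_).sub e2).congr fun n _ => ?_
    · rw [Multiset.card_cons]; push_cast; linarith
    · conv_rhs => rw [mcum, mquo_eq]
      rw [sub_div]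
      congr 1
      rw [← Multiset.sum_map_div]
      congr 1
      refine Multiset.map_congr rfl fun p _ => ?_
      rw [mul_div_assoc]
      rfl

/-- The constants in the leading odd term. -/
noncomputable def oddConst (β p q : ℝ) (c : ℕ) : ℝ :=
  (-(2 / β)) ^ c * c.factorial * (2 / β ^ 2 * (p - q) * ((p + q) + (2 - β) / 2))

lemma oddConst_succ (β p q : ℝ) (c : ℕ) :
    oddConst β p q (c + 1) = -(2 / β) * (c + 1) * oddConst β p q c := by
  rw [oddConst, oddConst, Nat.factorial_succ]
  push_cast
  ring

/-- The coefficient of the leading term in odd total degree. -/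
noncomputable def oddCoeff (β p q : ℝ) (m : ℕ) (S : Multiset ℕ) : ℝ :=
  if Odd (m + S.sum) then oddConst β p q S.card * m * S.prod else 0

/-- The subtracted cumulant with its leading odd term removed. -/
noncomputable def cerr (β p q : ℝ) (Z : Multiset ℕ → ℝ) (n m : ℕ) (S : Multiset ℕ) : ℝ :=
  crem β p q Z m S - oddCoeff β p q m S * (n : ℝ) ^ (-1 - S.card : ℤ)

/-- The parity of a natural number as an integer in `{0, 1}`. -/
def par (d : ℕ) : ℤ := if Odd d then 1 else 0

lemma powO_oddCoeff (β p q : ℝ) (m : ℕ) (S : Multiset ℕ) :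
    PowO (fun n => oddCoeff β p q m S * (n : ℝ) ^ (-1 - S.card : ℤ))
      (-S.card - par (m + S.sum)) := by
  by_cases h : Odd (m + S.sum)
  · rw [par, if_pos h]
    exact ((powO_zpow _).const_mul _).mono (by linarith)
  · simp only [oddCoeff, if_neg h, zero_mul]
    exact powO_zero _

lemma smul_msingle_of_odd {m : ℕ} {S : Multiset ℕ} (hS : Odd (m + S.sum)) (c : ℝ) :
    (c • msingle m) S = 0 := by
  have : S ≠ {m} := by
    rintro rfl
    rw [Multiset.sum_singleton] at hS
    exact (Nat.not_odd_iff_even.2 ⟨m, rfl⟩) hS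
  simp [msingle, this]

lemma cres_of_odd {β : ℝ} (hβ : β ≠ 0) (p q : ℝ) {m : ℕ} (hm : 1 ≤ m) {S : Multiset ℕ}
    (hS : Odd (m + S.sum)) :
    cres β p q m S = if S = 0 then -(β / 2) * (oddConst β p q 0 * m) else 0 := by
  have h1 := smul_msingle_of_odd hS (2 * m / β * cdiag β p q m - m / β * gpar p q (m + m))
  rw [cres, Pi.add_apply, h1, add_zero, Pi.smul_apply, mone]
  split_ifs with h
  · subst h
    rw [Multiset.sum_zero, add_zero] at hS
    have e1 : ∀ k ∈ Finset.Ico 1 m, gpar p q k * gpar p q (m - k) = (p + q) * (p - q) := by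
      intro k hk
      have hk := Finset.mem_Ico.1 hk
      rw [gpar, gpar]
      rcases Nat.even_or_odd k with h | h
      · rw [h.neg_one_pow, (Nat.Odd.sub_even hk.2.le hS h).neg_one_pow]; ring
      · rw [h.neg_one_pow, (Nat.Odd.sub_odd hS h).neg_one_pow]; ring
    have e2 : ∀ k ∈ Finset.Ico 1 m, (if m - k = k then 2 * (k : ℝ) / β else 0) = 0 := by
      intro k hk
      have hk := Finset.mem_Ico.1 hk
      rw [if_neg]
      intro h'
      exact (Nat.not_odd_iff_even.2 ⟨k, by omega⟩) hS
    rw [Finset.sum_congr rfl e1, Finset.sum_congr rfl e2]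
    simp only [Finset.sum_const, Nat.card_Ico, gpar, hS.neg_one_pow, cdiag, oddConst]
    rw [nsmul_eq_mul, Nat.cast_sub hm]
    simp only [pow_zero, Nat.factorial_zero, Nat.cast_one, smul_eq_mul]
    field_simp
    ring
  · simp

lemma powO_cres (β p q : ℝ) (m : ℕ) (S : Multiset ℕ) :
    PowO (fun _ => cres β p q m S) (1 - S.card) := by
  by_cases h : S.card ≤ 1
  · refine (powO_const _).mono ?_
    have : (S.card : ℤ) ≤ 1 := by exact_mod_cast h
    linarith
  · have h1 : S ≠ 0 := by rintro rfl; simp at h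
    have h2 : S ≠ {m} := by rintro rfl; simp at h
    simp only [cres, Pi.add_apply, Pi.smul_apply, mone, msingle, if_neg h1, if_neg h2, smul_zero,
      add_zero]
    exact powO_zero _

lemma par_nonneg (d : ℕ) : 0 ≤ par d := by unfold par; split_ifs <;> norm_num

lemma par_le_one (d : ℕ) : par d ≤ 1 := by unfold par; split_ifs <;> norm_num

lemma par_add_le (a b : ℕ) : par (a + b) ≤ par a + par b := by
  unfold par
  by_cases ha : Odd a <;> by_cases hb : Odd b <;>
    simp [Nat.odd_add, ha, hb, ← Nat.not_odd_iff_even]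

lemma odd_natAbs_sub_add_iff {m l s t : ℕ} (h : s + l = t) :
    Odd (((m : ℤ) - l).natAbs + s) ↔ Odd (m + t) := by
  rw [Nat.odd_iff, Nat.odd_iff]
  omega

lemma par_natAbs_sub_add {m l s t : ℕ} (h : s + l = t) :
    par (((m : ℤ) - l).natAbs + s) = par (m + t) := by
  unfold par
  simp only [odd_natAbs_sub_add_iff h]

lemma sgnSub_mul_natAbs (m l : ℕ) : sgnSub m l * (((m : ℤ) - l).natAbs : ℝ) = m - l := by
  unfold sgnSub
  rcases lt_trichotomy l m with h | h | h
  · rw [if_pos h, show ((m : ℤ) - l).natAbs = m - l by omega, Nat.cast_sub h.le, one_mul]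
  · subst h; simp
  · rw [if_neg h.le.not_gt, if_pos h, show ((m : ℤ) - l).natAbs = l - m by omega,
      Nat.cast_sub h.le]
    ring

lemma lead_loop_of_odd {β : ℝ} (hβ : β ≠ 0) (p q : ℝ) {m : ℕ} (hm : 1 ≤ m) {S : Multiset ℕ}
    (hS : Odd (m + S.sum)) {n : ℕ} (hn : 1 ≤ n) :
    β / 2 * n * (oddCoeff β p q m S * (n : ℝ) ^ (-1 - S.card : ℤ)) +
      (S.map fun l : ℕ => (l : ℝ) / 2 *
        (oddCoeff β p q (m + l) (S.erase l) * (n : ℝ) ^ (-1 - (S.erase l).card : ℤ) +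
          sgnSub m l * (oddCoeff β p q ((m : ℤ) - l).natAbs (S.erase l) *
            (n : ℝ) ^ (-1 - (S.erase l).card : ℤ)))).sum + cres β p q m S = 0 := by
  have hn0 : (n : ℝ) ≠ 0 := by positivity
  have e1 : ∀ l ∈ S, (l : ℝ) / 2 *
        (oddCoeff β p q (m + l) (S.erase l) * (n : ℝ) ^ (-1 - (S.erase l).card : ℤ) +
          sgnSub m l * (oddCoeff β p q ((m : ℤ) - l).natAbs (S.erase l) *
            (n : ℝ) ^ (-1 - (S.erase l).card : ℤ))) =
      oddConst β p q (S.card - 1) * m * S.prod * (n : ℝ) ^ (-S.card : ℤ) := by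
    intro l hl
    have hs := sum_erase_add hl
    have hc := card_erase_add hl
    have hpr : (l : ℝ) * (S.erase l).prod = S.prod := by
      rw [← Nat.cast_mul, Multiset.prod_erase hl]
    have h1 : Odd (m + l + (S.erase l).sum) := by rw [add_assoc, add_comm l, hs]; exact hS
    have h2 := (odd_natAbs_sub_add_iff (m := m) hs).2 hS
    have hc' : S.card - 1 = (S.erase l).card := by omega
    have hc'' : (-1 - (S.erase l).card : ℤ) = -S.card := by omega
    rw [oddCoeff, oddCoeff, if_pos h1, if_pos h2, hc', hc'', ← hpr]
    have h3 := sgnSub_mul_natAbs m l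
    rw [Nat.cast_add]
    linear_combination (l : ℝ) / 2 * (oddConst β p q (S.erase l).card * ((S.erase l).prod : ℝ) *
      (n : ℝ) ^ (-S.card : ℤ)) * h3
  rw [Multiset.map_congr rfl e1, Multiset.map_const', Multiset.sum_replicate, nsmul_eq_mul,
    cres_of_odd hβ p q hm hS, oddCoeff, if_pos hS]
  have hz : (n : ℝ) * (n : ℝ) ^ (-1 - S.card : ℤ) = (n : ℝ) ^ (-S.card : ℤ) := by
    rw [← zpow_one_add₀ hn0]; congr 1; ring
  by_cases h0 : S = 0
  · subst h0
    simp only [Multiset.card_zero, Multiset.prod_zero] at hz ⊢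
    simp only [Nat.cast_zero, neg_zero, zpow_zero, Nat.cast_one, if_true] at hz ⊢
    linear_combination β / 2 * (oddConst β p q 0 * m) * hz
  · obtain ⟨c, hc⟩ : ∃ c, S.card = c + 1 :=
      Nat.exists_eq_succ_of_ne_zero (by simpa using h0)
    rw [if_neg h0, hc, oddConst_succ]
    rw [hc] at hz
    rw [Nat.add_sub_cancel]
    have hβ' : β / 2 * (2 / β) = 1 := by field_simp
    simp only [Nat.cast_add, Nat.cast_one] at hz ⊢
    linear_combination (-(β / 2 * (2 / β)) * (c + 1) * oddConst β p q c * m * S.prod) * hz -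
      (c + 1) * oddConst β p q c * m * S.prod * (n : ℝ) ^ (-((c : ℤ) + 1)) * hβ'

lemma powO_lead_loop {β : ℝ} (hβ : β ≠ 0) (p q : ℝ) {m : ℕ} (hm : 1 ≤ m) (S : Multiset ℕ) :
    PowO (fun n => β / 2 * n * (oddCoeff β p q m S * (n : ℝ) ^ (-1 - S.card : ℤ)) +
      (S.map fun l : ℕ => (l : ℝ) / 2 *
        (oddCoeff β p q (m + l) (S.erase l) * (n : ℝ) ^ (-1 - (S.erase l).card : ℤ) +
          sgnSub m l * (oddCoeff β p q ((m : ℤ) - l).natAbs (S.erase l) *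
            (n : ℝ) ^ (-1 - (S.erase l).card : ℤ)))).sum + cres β p q m S)
      (1 - S.card - 2 * par (m + S.sum)) := by
  by_cases hS : Odd (m + S.sum)
  · exact (powO_zero _).congr fun n hn => (lead_loop_of_odd hβ p q hm hS hn).symm
  · have e : (1 - S.card - 2 * par (m + S.sum) : ℤ) = 1 - S.card := by simp [par, hS]
    rw [e]
    refine (powO_cres β p q m S).congr fun n hn => ?_
    have e1 : ∀ l ∈ S, (l : ℝ) / 2 *
        (oddCoeff β p q (m + l) (S.erase l) * (n : ℝ) ^ (-1 - (S.erase l).card : ℤ) +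
          sgnSub m l * (oddCoeff β p q ((m : ℤ) - l).natAbs (S.erase l) *
            (n : ℝ) ^ (-1 - (S.erase l).card : ℤ))) = 0 := by
      intro l hl
      have hs := sum_erase_add hl
      have h1 : ¬ Odd (m + l + (S.erase l).sum) := by rw [add_assoc, add_comm l, hs]; exact hS
      have h2 := (odd_natAbs_sub_add_iff (m := m) hs).not.2 hS
      rw [oddCoeff, oddCoeff, if_neg h1, if_neg h2]
      ring
    rw [Multiset.map_congr rfl e1, Multiset.map_const', Multiset.sum_replicate, oddCoeff, if_neg hS]
    simp

section Induction

variable {β p q : ℝ} {Z : ℕ → Multiset ℕ → ℝ}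

lemma crem_eq_cerr_add (n m : ℕ) (S : Multiset ℕ) :
    crem β p q (Z n) m S =
      cerr β p q (Z n) n m S + oddCoeff β p q m S * (n : ℝ) ^ (-1 - S.card : ℤ) := by
  rw [cerr]; ring

lemma PowO.crem_of_cerr {m : ℕ} {S : Multiset ℕ} {e : ℤ}
    (h : PowO (fun n => cerr β p q (Z n) n m S) e) (he : -S.card - par (m + S.sum) ≤ e) :
    PowO (fun n => crem β p q (Z n) m S) e :=
  (h.add ((powO_oddCoeff β p q m S).mono he)).congr fun n _ => (crem_eq_cerr_add n m S).symm

/-- The error bound in total degree `d`, weakened by `e` powers of `n`. -/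
def ErrBound (β p q : ℝ) (Z : ℕ → Multiset ℕ → ℝ) (d : ℕ) (e : ℤ) : Prop :=
  ∀ m S, 1 ≤ m → MPos S → m + S.sum = d →
    PowO (fun n => cerr β p q (Z n) n m S) (-S.card - 2 * par d + e)

lemma errBound_apriori (h0 : ∀ n, Z n 0 ≠ 0)
    (hZ : ∀ n S, |Z n S| ≤ (2 * n) ^ S.card * Z n 0) (d : ℕ) :
    ErrBound β p q Z d (2 * d + 3 : ℕ) := by
  intro m S hm hS hd
  have hc : (S.card : ℤ) ≤ d := by
    have := hS.card_le_sum
    omega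
  have hπ := par_le_one d
  have hπ0 := par_nonneg d
  have h1 := (powO_mcum h0 hZ m S).mono (e' := -S.card - 2 * par d + (2 * d + 3 : ℕ))
    (by push_cast; linarith)
  have h2 := (powO_const (clead β p q m S)).mono (e' := -S.card - 2 * par d + (2 * d + 3 : ℕ))
    (by push_cast; linarith)
  have h3 := (powO_oddCoeff β p q m S).mono (e' := -S.card - 2 * par d + (2 * d + 3 : ℕ))
    (by rw [hd]; push_cast; linarith)
  exact (h1.sub h2).sub h3

lemma powO_crem_of_errBound {d : ℕ} (h : ErrBound β p q Z d 0) {m : ℕ} {S : Multiset ℕ}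
    (hm : 1 ≤ m) (hS : MPos S) (hd : m + S.sum = d) :
    PowO (fun n => crem β p q (Z n) m S) (-S.card - par d) := by
  have hπ0 := par_nonneg d
  exact ((h m S hm hS hd).mono (by linarith)).crem_of_cerr (by rw [hd])

lemma powO_mconv_crem {m : ℕ} {S : Multiset ℕ} (hS : MPos S)
    (hlow : ∀ d < m + S.sum, ErrBound β p q Z d 0) {k : ℕ} (hk : k ∈ Finset.Ico 1 m) :
    PowO (fun n => mconv (crem β p q (Z n) k) (crem β p q (Z n) (m - k)) S)
      (-S.card - par (m + S.sum)) := by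
  have hk := Finset.mem_Ico.1 hk
  unfold mconv
  refine PowO.multiset_sum (f := fun (r : Multiset ℕ × Multiset ℕ) n =>
    crem β p q (Z n) k r.1 * crem β p q (Z n) (m - k) r.2) fun r hr => ?_
  have hr := Multiset.mem_antidiagonal.1 hr
  have hs : r.1.sum + r.2.sum = S.sum := by rw [← hr, Multiset.sum_add]
  have hc : r.1.card + r.2.card = S.card := by rw [← hr, Multiset.card_add]
  have h1 := powO_crem_of_errBound (hlow (k + r.1.sum) (by omega)) hk.1
    (hS.mono (hr ▸ Multiset.le_add_right _ _)) rfl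
  have h2 := powO_crem_of_errBound (m := m - k) (hlow (m - k + r.2.sum) (by omega)) (by omega)
    (hS.mono (hr ▸ Multiset.le_add_left _ _)) rfl
  refine (h1.mul h2).mono ?_
  have h3 := par_add_le (k + r.1.sum) (m - k + r.2.sum)
  rw [show k + r.1.sum + (m - k + r.2.sum) = m + S.sum by omega] at h3
  rw [← hc]
  push_cast
  linarith

lemma errBound_step (hβ : β ≠ 0) (hML : ∀ n : ℕ, MomentLoop β p q n (Z n)) {d : ℕ}
    (hlow : ∀ d' < d, ErrBound β p q Z d' 0) (e : ℕ) (he : ErrBound β p q Z d (e + 1 : ℕ)) :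
    ErrBound β p q Z d e := by
  intro m S
  induction hc : S.card using Nat.strong_induction_on generalizing m S with
  | _ c ih =>
  intro hm hS hd
  have hπ := par_le_one d
  have hπ0 := par_nonneg d
  have he0 : (0 : ℤ) ≤ e := by positivity
  have t1 : PowO (fun n => cdiag β p q m * crem β p q (Z n) m S) (1 - c - 2 * par d + e) := by
    refine PowO.const_mul _ (PowO.crem_of_cerr ((he m S hm hS hd).mono ?_) ?_)
    · rw [hc]; push_cast; linarith
    · rw [hc, hd]; linarith
  have t2 : PowO (fun n => ∑ k ∈ Finset.Ico 1 m, (crem β p q (Z n) k ((m - k) ::ₘ S) +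
      mconv (crem β p q (Z n) k) (crem β p q (Z n) (m - k)) S)) (1 - c - 2 * par d + e) := by
    refine PowO.finset_sum fun k hk => PowO.add ?_ ?_
    · have hk := Finset.mem_Ico.1 hk
      have hd' : k + ((m - k) ::ₘ S).sum = d := by rw [Multiset.sum_cons]; omega
      refine PowO.crem_of_cerr ((he k _ hk.1 (hS.cons (by omega)) hd').mono ?_) ?_
      · rw [Multiset.card_cons, hc]; push_cast; linarith
      · rw [Multiset.card_cons, hc, hd']; push_cast; linarith
    · refine (powO_mconv_crem hS (fun d' h => hlow d' (hd ▸ h)) hk).mono ?_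
      rw [hc, hd]; linarith
  have t3 : PowO (fun n => (S.map fun l : ℕ => (l : ℝ) / 2 *
      (cerr β p q (Z n) n (m + l) (S.erase l) +
        sgnSub m l * cerr β p q (Z n) n ((m : ℤ) - l).natAbs (S.erase l))).sum)
      (1 - c - 2 * par d + e) := by
    refine PowO.multiset_sum (f := fun (l : ℕ) n => (l : ℝ) / 2 *
      (cerr β p q (Z n) n (m + l) (S.erase l) +
        sgnSub m l * cerr β p q (Z n) n ((m : ℤ) - l).natAbs (S.erase l)))
      fun l hl => PowO.const_mul _ (PowO.add ?_ ?_)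
    · have hs := sum_erase_add hl
      have hc' := card_erase_add hl
      refine (ih (S.erase l).card (by omega) (m + l) _ rfl (by omega)
        (hS.mono (Multiset.erase_le _ _)) (by omega)).mono ?_
      have : ((S.erase l).card : ℤ) + 1 = c := by exact_mod_cast hc'.trans hc
      linarith
    · have hs := sum_erase_add hl
      have hc' := card_erase_add hl
      have hl1 := hS l hl
      by_cases hml : m = l
      · subst hml
        simp only [sgnSub, lt_irrefl, if_false, zero_mul]
        exact powO_zero _
      · refine PowO.const_mul _ ((hlow (((m : ℤ) - l).natAbs + (S.erase l).sum) (by omega) _ _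
          (by omega) (hS.mono (Multiset.erase_le _ _)) rfl).mono ?_)
        rw [par_natAbs_sub_add hs, hd]
        have : ((S.erase l).card : ℤ) + 1 = c := by exact_mod_cast hc'.trans hc
        linarith
  have t4 := (powO_lead_loop hβ p q hm S).mono (e' := 1 - c - 2 * par d + e)
    (by rw [hc, hd]; linarith)
  refine PowO.of_mul_self (c := β / 2) (by simpa using hβ) ?_
  rw [show (1 + (-c - 2 * par d + e) : ℤ) = 1 - c - 2 * par d + e by ring]
  refine (((t1.add (t2.const_mul (β / 4))).add t3).add t4).neg.congr fun n hn => ?_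
  have hl := congrFun ((hML n).crem_loop hβ hm) S
  simp only [Pi.add_apply, Pi.smul_apply, smul_eq_mul, msplit, mshift, Finset.sum_apply,
    Pi.zero_apply] at hl
  simp only [crem_eq_cerr_add n _ (S.erase _)] at hl
  have hsum : (S.map fun l : ℕ => (l : ℝ) / 2 *
      (cerr β p q (Z n) n (m + l) (S.erase l) +
          oddCoeff β p q (m + l) (S.erase l) * (n : ℝ) ^ (-1 - (S.erase l).card : ℤ) +
        sgnSub m l * (cerr β p q (Z n) n ((m : ℤ) - l).natAbs (S.erase l) +
          oddCoeff β p q ((m : ℤ) - l).natAbs (S.erase l) *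
            (n : ℝ) ^ (-1 - (S.erase l).card : ℤ)))).sum =
      (S.map fun l : ℕ => (l : ℝ) / 2 *
      (cerr β p q (Z n) n (m + l) (S.erase l) +
        sgnSub m l * cerr β p q (Z n) n ((m : ℤ) - l).natAbs (S.erase l))).sum +
      (S.map fun l : ℕ => (l : ℝ) / 2 *
        (oddCoeff β p q (m + l) (S.erase l) * (n : ℝ) ^ (-1 - (S.erase l).card : ℤ) +
          sgnSub m l * (oddCoeff β p q ((m : ℤ) - l).natAbs (S.erase l) *
            (n : ℝ) ^ (-1 - (S.erase l).card : ℤ)))).sum := by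
    rw [← Multiset.sum_map_add]
    congr 1
    exact Multiset.map_congr rfl fun l _ => by ring
  rw [hsum] at hl
  have hv := crem_eq_cerr_add (β := β) (p := p) (q := q) (Z := Z) n m S
  linear_combination -hl + β * n / 2 * hv

lemma errBound_zero (hβ : β ≠ 0) (hML : ∀ n : ℕ, MomentLoop β p q n (Z n))
    (hZ : ∀ n S, |Z n S| ≤ (2 * n) ^ S.card * Z n 0) (d : ℕ) : ErrBound β p q Z d 0 := by
  induction d using Nat.strong_induction_on with
  | _ d ih =>
  have key : ∀ e : ℕ, ErrBound β p q Z d e → ErrBound β p q Z d 0 := by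
    intro e
    induction e with
    | zero => exact id
    | succ e ihe => exact fun h => ihe (errBound_step hβ hML ih e h)
  exact key _ (errBound_apriori (fun n => (hML n).ne_zero) hZ d)

theorem tendsto_mcum_of_odd (hβ : β ≠ 0) (hML : ∀ n : ℕ, MomentLoop β p q n (Z n))
    (hZ : ∀ n S, |Z n S| ≤ (2 * n) ^ S.card * Z n 0) {m : ℕ} {S : Multiset ℕ} (hm : 1 ≤ m)
    (hS : MPos S) (hS0 : S ≠ 0) (hodd : Odd (m + S.sum)) :
    Tendsto (fun n : ℕ => (n : ℝ) ^ (S.card + 1) * mcum (Z n) m S) atTop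
      (nhds (oddConst β p q S.card * m * S.prod)) := by
  have h := errBound_zero (p := p) (q := q) hβ hML hZ (m + S.sum) m S hm hS rfl
  rw [par, if_pos hodd] at h
  have h1 : PowO (fun n : ℕ => (n : ℝ) ^ (S.card + 1 : ℤ) * cerr β p q (Z n) n m S) (-1) :=
    ((powO_zpow _).mul h).mono (by linarith)
  have h2 : Tendsto (fun n : ℕ => (n : ℝ) ^ (S.card + 1 : ℤ) * cerr β p q (Z n) n m S) atTop
      (nhds 0) := by
    refine Asymptotics.IsBigO.trans_tendsto h1 ?_
    simpa using tendsto_inv_atTop_nhds_zero_nat (𝕜 := ℝ)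
  have h3 := h2.add_const (oddConst β p q S.card * m * S.prod)
  rw [zero_add] at h3
  refine h3.congr' ?_
  filter_upwards [eventually_ge_atTop 1] with n hn
  have hn0 : (n : ℝ) ≠ 0 := by positivity
  have hlead : clead β p q m S = 0 := by
    rw [clead, Pi.add_apply, smul_msingle_of_odd hodd, Pi.smul_apply, mone, if_neg hS0,
      smul_zero, add_zero]
  have hz : (n : ℝ) ^ (S.card + 1 : ℤ) * (n : ℝ) ^ (-1 - S.card : ℤ) = 1 := by
    rw [← zpow_add₀ hn0, show (S.card + 1 + (-1 - S.card) : ℤ) = 0 by ring, zpow_zero]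
  have hz' : (n : ℝ) ^ (S.card + 1 : ℤ) = (n : ℝ) ^ (S.card + 1) := by exact_mod_cast rfl
  rw [cerr, crem, Pi.sub_apply, hlead, oddCoeff, if_pos hodd, ← hz']
  linear_combination -(oddConst β p q S.card * m * S.prod) * hz

end Induction

/-- The shifted Chebyshev polynomial of the first kind. -/
noncomputable def chT (i : ℤ) (x : ℝ) : ℝ := (Polynomial.Chebyshev.T ℝ i).eval (2 * x - 1)

/-- The shifted Chebyshev polynomial of the second kind, of degree `i - 1`. -/
noncomputable def chU (i : ℤ) (x : ℝ) : ℝ := (Polynomial.Chebyshev.U ℝ (i - 1)).eval (2 * x - 1)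

lemma chT_zero (x : ℝ) : chT 0 x = 1 := by simp [chT]

lemma chT_one (x : ℝ) : chT 1 x = 2 * x - 1 := by simp [chT]

lemma chU_zero (x : ℝ) : chU 0 x = 0 := by simp [chU]

lemma chU_one (x : ℝ) : chU 1 x = 1 := by simp [chU]

lemma chT_neg (i : ℤ) (x : ℝ) : chT (-i) x = chT i x := by simp [chT]

lemma chT_natAbs (i : ℤ) (x : ℝ) : chT i.natAbs x = chT i x := by
  rw [chT, Polynomial.Chebyshev.T_natAbs, chT]

lemma chT_add_one (i : ℤ) (x : ℝ) :
    chT (i + 1) x = 2 * (2 * x - 1) * chT i x - chT (i - 1) x := by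
  rw [chT, Polynomial.Chebyshev.T_add_one]; simp [chT]

lemma chU_add_one (i : ℤ) (x : ℝ) :
    chU (i + 1) x = 2 * (2 * x - 1) * chU i x - chU (i - 1) x := by
  rw [chU, show i + 1 - 1 = (i - 1) + 1 by ring, Polynomial.Chebyshev.U_add_one]; simp [chU]

lemma chU_add_one' (i : ℤ) (x : ℝ) : chU (i + 1) x = (2 * x - 1) * chU i x + chT i x := by
  rw [chU, show i + 1 - 1 = (i - 1) + 1 by ring, Polynomial.Chebyshev.U_eq_X_mul_U_add_T]
  simp [chU, chT]

lemma chT_sub_chT (i : ℤ) (x : ℝ) :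
    chT (i - 1) x - chT (i + 1) x = 2 * (1 - (2 * x - 1) ^ 2) * chU i x := by
  have h := congrArg (Polynomial.eval (2 * x - 1))
    (Polynomial.Chebyshev.one_sub_X_sq_mul_U_eq_pol_in_T ℝ (i - 1))
  rw [show i - 1 + 1 = i by ring, show i - 1 + 2 = i + 1 by ring] at h
  simp only [Polynomial.eval_mul, Polynomial.eval_sub, Polynomial.eval_one, Polynomial.eval_pow,
    Polynomial.eval_X] at h
  have h2 := chT_add_one i x
  simp only [chT, chU] at *
  linarith

lemma two_mul_chT (i : ℤ) (x : ℝ) : 2 * chT i x = chU (i + 1) x - chU (i - 1) x := by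
  have h1 := chU_add_one i x
  have h2 := chU_add_one' i x
  linarith

lemma two_mul_chT_mul_chT (i j : ℤ) (x : ℝ) :
    2 * chT i x * chT j x = chT (i + j) x + chT (i - j) x := by
  have h := congrArg (Polynomial.eval (2 * x - 1)) (Polynomial.Chebyshev.T_mul_T ℝ i j)
  simpa [chT, mul_assoc] using h

lemma chU_mul_chU (i : ℤ) (l : ℕ) (x : ℝ) :
    2 * (1 - (2 * x - 1) ^ 2) * (chU i x * chU l x) = chT (i - l) x - chT (i + l) x := by
  induction l using Nat.twoStepInduction with
  | zero => simp [chU_zero]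
  | one => push_cast; rw [chT_sub_chT, chU_one]; ring
  | more l h0 h1 =>
    push_cast at *
    have e1 := chU_add_one (l + 1) x
    have e2 := chT_add_one (i + (l + 1)) x
    have e3 := chT_add_one (i - (l + 1)) x
    rw [show (l : ℤ) + 1 + 1 = l + 2 by ring, show (l : ℤ) + 1 - 1 = l by ring] at e1
    rw [show i + ((l : ℤ) + 1) + 1 = i + (l + 2) by ring,
      show i + ((l : ℤ) + 1) - 1 = i + l by ring] at e2
    rw [show i - ((l : ℤ) + 1) + 1 = i - l by ring,
      show i - ((l : ℤ) + 1) - 1 = i - (l + 2) by ring] at e3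
    rw [e1]
    linear_combination 2 * (2 * x - 1) * h1 - h0 + e2 - e3

lemma sum_Ico_one_succ (m : ℕ) (hm : 1 ≤ m) (f : ℕ → ℝ) :
    ∑ k ∈ Finset.Ico 1 (m + 1), f k = ∑ k ∈ Finset.Ico 1 m, f k + f m :=
  Finset.sum_Ico_succ_top hm f

lemma chU_edge_one {m : ℕ} (hm : 1 ≤ m) (x : ℝ) :
    2 * x * chU m x = 1 + ∑ j ∈ Finset.Ico 1 m, 2 * chT j x + chT m x := by
  induction m, hm using Nat.le_induction with
  | base => simp [chU_one, chT_one]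
  | succ m hm ih =>
    rw [sum_Ico_one_succ m hm]
    push_cast
    have h1 := chU_add_one' m x
    have h2 := chU_add_one' (m + 1) x
    have h3 := chU_add_one (m + 1) x
    rw [show (m : ℤ) + 1 - 1 = m by ring] at h3
    linear_combination ih + h1 + h2 - h3

lemma chU_edge_zero {m : ℕ} (hm : 1 ≤ m) (x : ℝ) :
    2 * (1 - x) * chU m x =
      -(-1) ^ m * (1 + ∑ j ∈ Finset.Ico 1 m, (-1) ^ j * (2 * chT j x) + (-1) ^ m * chT m x) := by
  have hs : ∀ m : ℕ, ((-1 : ℝ) ^ m) * (-1) ^ m = 1 := fun m => by rw [← mul_pow]; simp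
  have key : (-1) ^ m * (2 * (1 - x) * chU m x) =
      -(1 + ∑ j ∈ Finset.Ico 1 m, (-1) ^ j * (2 * chT j x) + (-1) ^ m * chT m x) := by
    induction m, hm using Nat.le_induction with
    | base => simp [chU_one, chT_one]; ring
    | succ m hm ih =>
      rw [sum_Ico_one_succ m hm]
      push_cast
      have h1 := chU_add_one' m x
      have h2 := chU_add_one' (m + 1) x
      have h3 := chU_add_one (m + 1) x
      rw [show (m : ℤ) + 1 - 1 = m by ring] at h3
      rw [pow_succ]
      linear_combination ih - (-1) ^ m * h1 + (-1) ^ m * h2 - (-1) ^ m * h3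
  linear_combination (-1) ^ m * key - (2 * (1 - x) * chU m x) * hs m

lemma sum_chT_mul_chT_aux (m : ℤ) (M : ℕ) (x y : ℝ) :
    4 * (x - y) * ∑ k ∈ Finset.range M, chT (m - (k + 1)) x * chT (k + 1) y =
      chT (m - M - 1) x * chT M y - chT (m - M) x * chT (M + 1) y -
        (chT (m - 1) x - chT m x * chT 1 y) := by
  induction M with
  | zero => simp [chT_zero]
  | succ M ih =>
    rw [Finset.sum_range_succ, mul_add, ih]
    have h1 := chT_add_one (m - (M + 1)) x
    have h2 := chT_add_one (M + 1) y
    push_cast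
    rw [show m - ((M : ℤ) + 1) + 1 = m - M by ring] at h1
    rw [show (M : ℤ) + 1 - 1 = M by ring] at h2
    rw [show m - (M : ℤ) - 1 = m - (M + 1) by ring]
    linear_combination chT (M + 1) y * h1 * (-1) + chT (m - (M + 1)) x * h2

lemma chU_pair (m : ℕ) (x y : ℝ) :
    x * (1 - x) * chU m x - y * (1 - y) * chU m y = -((x - y) / 2) *
      ∑ k ∈ Finset.range m, (chT (m - (k + 1)) x * chT (k + 1) y +
        chT (m - (k + 1)) y * chT (k + 1) x) := by
  have h1 := sum_chT_mul_chT_aux m m x y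
  have h2 := sum_chT_mul_chT_aux m m y x
  have h3 := chT_sub_chT m x
  have h4 := chT_sub_chT m y
  rw [sub_self, zero_sub, chT_neg, chT_one, chT_one, chT_zero] at h1 h2
  rw [Finset.sum_add_distrib]
  linear_combination (1 / 8) * (h1 - h2) - (1 / 8) * (h3 - h4)

lemma sum_chT_mul_chT_self (m : ℕ) (x : ℝ) :
    2 * ∑ k ∈ Finset.range m, chT (m - (k + 1)) x * chT (k + 1) x =
      m * chT m x + (2 * x - 1) * chU m x := by
  have key : ∀ M : ℕ, 4 * ∑ k ∈ Finset.range M, chT (m - (k + 1)) x * chT (k + 1) x =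
      2 * M * chT m x + chU (m - 1) x - chU (m - 2 * M - 1) x := by
    intro M
    induction M with
    | zero => simp
    | succ M ih =>
      rw [Finset.sum_range_succ, mul_add, ih]
      have h1 := two_mul_chT_mul_chT (m - (M + 1)) (M + 1) x
      have h2 := two_mul_chT (m - 2 * (M + 1)) x
      push_cast
      rw [show (m : ℤ) - (M + 1) + (M + 1) = m by ring,
        show (m : ℤ) - (M + 1) - (M + 1) = m - 2 * (M + 1) by ring] at h1
      rw [show (m : ℤ) - 2 * (M + 1) + 1 = m - 2 * M - 1 by ring] at h2
      linear_combination 2 * h1 + h2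
  have h1 := key m
  have h2 : chU (m - 2 * m - 1) x = - chU (m + 1) x := by
    rw [chU, chU, show (m : ℤ) - 2 * m - 1 - 1 = -(m : ℤ) - 2 by ring,
      Polynomial.Chebyshev.U_neg_sub_two, show (m : ℤ) + 1 - 1 = m by ring, Polynomial.eval_neg]
  have h3 := chU_add_one m x
  rw [h2] at h1
  linear_combination h1 / 2 + h3 / 2

lemma hasDerivAt_chT (m : ℕ) (x : ℝ) : HasDerivAt (chT m) (2 * m * chU m x) x := by
  have h := HasDerivAt.comp (h := fun x : ℝ => 2 * x - 1) x
    ((Polynomial.Chebyshev.T ℝ m).hasDerivAt (2 * x - 1))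
    (((hasDerivAt_id' x).const_mul 2).sub_const 1)
  refine HasDerivAt.congr_deriv (f := chT m) h ?_
  rw [Polynomial.Chebyshev.T_derivative_eq_U, chU]
  simp only [Polynomial.eval_mul, Int.cast_natCast, Polynomial.eval_natCast]
  ring

/-- The derivative of `chU m`. -/
noncomputable def chU' (m : ℕ) (x : ℝ) : ℝ :=
  2 * (Polynomial.derivative (Polynomial.Chebyshev.U ℝ (m - 1))).eval (2 * x - 1)

lemma hasDerivAt_chU (m : ℕ) (x : ℝ) : HasDerivAt (chU m) (chU' m x) x := by
  have h := HasDerivAt.comp (h := fun x : ℝ => 2 * x - 1) x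
    ((Polynomial.Chebyshev.U ℝ (m - 1)).hasDerivAt (2 * x - 1))
    (((hasDerivAt_id' x).const_mul 2).sub_const 1)
  refine HasDerivAt.congr_deriv (f := chU m) h ?_
  rw [chU']
  ring

lemma continuous_chT (m : ℤ) : Continuous (chT m) := by
  unfold chT; fun_prop

lemma continuous_chU (m : ℤ) : Continuous (chU m) := by
  unfold chU; fun_prop

lemma continuous_chU' (m : ℕ) : Continuous (chU' m) := by
  unfold chU'; fun_prop

lemma chU_deriv_identity (m : ℕ) (x : ℝ) :
    -2 * ((1 - 2 * x) * chU m x + x * (1 - x) * chU' m x) = m * chT m x + (2 * x - 1) * chU m x := by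
  have h := congrArg (Polynomial.eval (2 * x - 1))
    (Polynomial.Chebyshev.add_one_mul_T_eq_poly_in_U (R := ℝ) (m - 1))
  rw [show (m : ℤ) - 1 + 1 = m by ring] at h
  simp at h
  simp only [chT, chU, chU']
  linear_combination -h

lemma abs_chT_le_one (m : ℤ) {x : ℝ} (h0 : 0 ≤ x) (h1 : x ≤ 1) : |chT m x| ≤ 1 :=
  Polynomial.Chebyshev.abs_eval_T_real_le_one m (abs_le.2 ⟨by linarith, by linarith⟩)

/-- Integration by parts in the `i`-th variable over the unit cube. -/
lemma setIntegral_cube_eq_zero {n : ℕ} (i : Fin n) {G D : (Fin n → ℝ) → ℝ}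
    (hD : IntegrableOn D (Set.Icc 0 1))
    (hc : ∀ T ∈ Set.Icc (0 : Fin n → ℝ) 1,
      ContinuousOn (fun t => G (Function.update T i t)) (Set.Icc 0 1))
    (h0 : ∀ T, G (Function.update T i 0) = 0) (h1 : ∀ T, G (Function.update T i 1) = 0)
    (hd : ∀ T t, t ∈ Set.Ioo (0 : ℝ) 1 → (∀ j, j ≠ i → T j ≠ t) →
      HasDerivAt (fun t => G (Function.update T i t)) (D (Function.update T i t)) t) :
    ∫ T in Set.Icc (0 : Fin n → ℝ) 1, D T = 0 := by
  obtain ⟨k, rfl⟩ : ∃ k, n = k + 1 := ⟨n - 1, by have := i.pos; omega⟩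
  set e : ℝ × (Fin k → ℝ) ≃ᵐ (Fin (k + 1) → ℝ) :=
    (MeasurableEquiv.piFinSuccAbove (fun _ => ℝ) i).symm
  have hem : MeasurePreserving e :=
    (volume_preserving_piFinSuccAbove (fun _ : Fin (k + 1) => ℝ) i).symm _
  have heπ : (e ⁻¹' Set.Icc 0 1) = Set.Icc (0 : ℝ) 1 ×ˢ Set.Icc (0 : Fin k → ℝ) 1 :=
    ((Fin.insertNthOrderIso (fun _ => ℝ) i).preimage_Icc _ _).trans (Set.Icc_prod_eq _ _)
  have he : ∀ t y, e (t, y) = Function.update (e (0, y)) i t := fun t y => by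
    change i.insertNth (α := fun _ => ℝ) t y =
      Function.update (i.insertNth (α := fun _ => ℝ) 0 y) i t
    rw [Fin.update_insertNth]
  have hi : IntegrableOn (fun p => D (e p)) (Set.Icc (0 : ℝ) 1 ×ˢ Set.Icc (0 : Fin k → ℝ) 1)
      (volume.prod volume) := by
    rw [← heπ, ← Measure.volume_eq_prod]
    exact (hem.integrableOn_comp_preimage e.measurableEmbedding).2 hD
  rw [← hem.map_eq, setIntegral_map_equiv, heπ, Measure.volume_eq_prod, ← Measure.prod_restrict]
  rw [IntegrableOn, ← Measure.prod_restrict] at hi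
  rw [integral_prod_symm _ hi]
  refine integral_eq_zero_of_ae ?_
  filter_upwards [hi.prod_left_ae, ae_restrict_mem measurableSet_Icc] with y hy hyI
  have hT : e (0, y) ∈ Set.Icc (0 : Fin (k + 1) → ℝ) 1 := by
    rw [← Set.mem_preimage, heπ]
    exact ⟨by simp, hyI⟩
  have key := integral_eq_of_hasDerivAt_off_countable_of_le
    (fun t => G (Function.update (e (0, y)) i t)) (fun t => D (Function.update (e (0, y)) i t))
    zero_le_one (Set.countable_range fun j : {j // j ≠ i} => e (0, y) j) (hc _ hT)
    (fun t ht => hd _ t ht.1 fun j hj h => ht.2 ⟨⟨j, hj⟩, h⟩)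
    (by
      rw [intervalIntegrable_iff_integrableOn_Icc_of_le zero_le_one]
      exact hy.congr (.of_forall fun t => congrArg D (he t y)))
  simp only [h0, h1, sub_zero] at key
  rw [intervalIntegral.integral_of_le zero_le_one, ← integral_Icc_eq_integral_Ioc] at key
  exact (setIntegral_congr_fun measurableSet_Icc fun t _ => congrArg D (he t y)).trans key

/-- A measurable function that is bounded on the unit cube. -/
def BddCube {n : ℕ} (f : (Fin n → ℝ) → ℝ) : Prop :=
  Measurable f ∧ ∃ C, ∀ T ∈ Set.Icc (0 : Fin n → ℝ) 1, |f T| ≤ C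

lemma Continuous.bddCube {n : ℕ} {f : (Fin n → ℝ) → ℝ} (hf : Continuous f) : BddCube f :=
  ⟨hf.measurable, (isCompact_Icc.exists_bound_of_continuousOn hf.continuousOn)⟩

lemma BddCube.add {n : ℕ} {f g : (Fin n → ℝ) → ℝ} (hf : BddCube f) (hg : BddCube g) :
    BddCube (fun T => f T + g T) := by
  obtain ⟨C, hC⟩ := hf.2
  obtain ⟨C', hC'⟩ := hg.2
  exact ⟨hf.1.add hg.1, C + C', fun T hT => (abs_add_le _ _).trans (add_le_add (hC T hT) (hC' T hT))⟩

lemma BddCube.mul {n : ℕ} {f g : (Fin n → ℝ) → ℝ} (hf : BddCube f) (hg : BddCube g) :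
    BddCube (fun T => f T * g T) := by
  obtain ⟨C, hC⟩ := hf.2
  obtain ⟨C', hC'⟩ := hg.2
  refine ⟨hf.1.mul hg.1, C * C', fun T hT => ?_⟩
  rw [abs_mul]
  exact mul_le_mul (hC T hT) (hC' T hT) (abs_nonneg _) ((abs_nonneg _).trans (hC T hT))

lemma BddCube.sum {n : ℕ} {ι : Type*} (s : Finset ι) {f : ι → (Fin n → ℝ) → ℝ}
    (hf : ∀ a ∈ s, BddCube (f a)) : BddCube (fun T => ∑ a ∈ s, f a T) := by
  classical
  induction s using Finset.induction with
  | empty => simpa using (continuous_const (y := (0 : ℝ))).bddCube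
  | insert a s ha ih =>
    simp_rw [Finset.sum_insert ha]
    exact (hf a (by simp)).add (ih fun b hb => hf b (by simp [hb]))

/-- The one-body weight. -/
noncomputable def obW (α δ : ℝ) (x : ℝ) : ℝ := x ^ α * (1 - x) ^ (δ / 2)

lemma obW_nonneg (α δ : ℝ) {x : ℝ} (h0 : 0 ≤ x) (h1 : x ≤ 1) : 0 ≤ obW α δ x :=
  mul_nonneg (Real.rpow_nonneg h0 _) (Real.rpow_nonneg (by linarith) _)

lemma integrableOn_obW {α δ : ℝ} (hα : -1 < α) (hδ : -2 < δ) :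
    IntegrableOn (obW α δ) (Set.Icc 0 1) := by
  have h := (Complex.betaIntegral_convergent (u := (α + 1 : ℝ)) (v := (δ / 2 + 1 : ℝ))
    (by simp; linarith) (by simp; linarith)).norm
  rw [intervalIntegrable_iff_integrableOn_Ioo_of_le zero_le_one] at h
  rw [integrableOn_Icc_iff_integrableOn_Ioo]
  refine h.congr_fun (fun x hx => ?_) measurableSet_Ioo
  have h2 : (0 : ℝ) < 1 - x := by linarith [hx.2]
  have e : (1 - (x : ℂ)) = ((1 - x : ℝ) : ℂ) := by push_cast; ring
  simp only [norm_mul]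
  rw [e, Complex.norm_cpow_eq_rpow_re_of_pos hx.1, Complex.norm_cpow_eq_rpow_re_of_pos h2]
  simp [obW]

lemma integrableOn_prod_obW {α δ : ℝ} (hα : -1 < α) (hδ : -2 < δ) (n : ℕ) :
    IntegrableOn (fun T : Fin n → ℝ => ∏ j, obW α δ (T j)) (Set.Icc 0 1) := by
  have h := Integrable.fintype_prod (f := fun _ : Fin n => obW α δ)
    (μ := fun _ => volume.restrict (Set.Icc 0 1)) fun _ => integrableOn_obW hα hδ
  rwa [← Measure.restrict_pi_pi, Set.pi_univ_Icc] at h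

lemma BddCube.integrableOn {α δ : ℝ} (hα : -1 < α) (hδ : -2 < δ) {n : ℕ} {f : (Fin n → ℝ) → ℝ}
    (hf : BddCube f) :
    IntegrableOn (fun T => f T * ∏ j, obW α δ (T j)) (Set.Icc 0 1) := by
  obtain ⟨C, hC⟩ := hf.2
  exact (integrableOn_prod_obW hα hδ n).bdd_mul hf.1.aestronglyMeasurable
    ((ae_restrict_iff' measurableSet_Icc).2 (.of_forall hC))

/-- The linear statistic attached to the `m`-th Chebyshev polynomial. -/
noncomputable def chX {n : ℕ} (m : ℕ) (T : Fin n → ℝ) : ℝ := ∑ i, 2 * chT m (T i)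

/-- The monomial in the linear statistics `chX`. -/
noncomputable def chXprod {n : ℕ} (S : Multiset ℕ) (T : Fin n → ℝ) : ℝ :=
  (S.map fun l => chX l T).prod

lemma continuous_chX {n : ℕ} (m : ℕ) : Continuous (chX (n := n) m) := by
  unfold chX
  exact continuous_finsetSum _ fun i _ =>
    continuous_const.mul ((continuous_chT m).comp (continuous_apply i))

lemma chXprod_zero {n : ℕ} (T : Fin n → ℝ) : chXprod 0 T = 1 := by simp [chXprod]

lemma chXprod_cons {n : ℕ} (l : ℕ) (S : Multiset ℕ) (T : Fin n → ℝ) :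
    chXprod (l ::ₘ S) T = chX l T * chXprod S T := by simp [chXprod]

lemma continuous_chXprod {n : ℕ} (S : Multiset ℕ) : Continuous (chXprod (n := n) S) := by
  induction S using Multiset.induction with
  | empty => simpa [funext chXprod_zero] using continuous_const
  | cons a S ih =>
    rw [funext (chXprod_cons a S)]
    exact (continuous_chX a).mul ih

lemma jacW_eq (β α δ : ℝ) (n : ℕ) (T : Fin n → ℝ) :
    jacW β α δ n T = vand β T * ∏ j, obW α δ (T j) := mul_comm _ _

lemma vand_eq_sigma (β : ℝ) {n : ℕ} (T : Fin n → ℝ) :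
    vand β T = ∏ p ∈ Finset.univ.sigma fun j : Fin n => Finset.Ioi j, |T p.2 - T p.1| ^ β :=
  Finset.prod_sigma' _ _ _

lemma continuous_vand {β : ℝ} (hβ : 0 ≤ β) (n : ℕ) : Continuous (vand β (n := n)) := by
  unfold vand
  exact continuous_finsetProd _ fun j _ => continuous_finsetProd _ fun k _ =>
    ((continuous_apply k).sub (continuous_apply j)).abs.rpow_const fun _ => Or.inr hβ

lemma vand_nonneg (β : ℝ) {n : ℕ} (T : Fin n → ℝ) : 0 ≤ vand β T :=
  Finset.prod_nonneg fun _ _ => Finset.prod_nonneg fun _ _ => Real.rpow_nonneg (abs_nonneg _) _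

lemma abs_sub_le_one_of_mem_cube {n : ℕ} {T : Fin n → ℝ} (hT : T ∈ Set.Icc (0 : Fin n → ℝ) 1)
    (j k : Fin n) : |T k - T j| ≤ 1 := by
  have h1 := hT.1 j
  have h2 := hT.1 k
  have h3 := hT.2 j
  have h4 := hT.2 k
  simp only [Pi.zero_apply, Pi.one_apply] at h1 h2 h3 h4
  exact abs_le.2 ⟨by linarith, by linarith⟩

lemma abs_div_mul_vand_le {β : ℝ} (hβ : 1 ≤ β) {n : ℕ} {T : Fin n → ℝ}
    (hT : T ∈ Set.Icc (0 : Fin n → ℝ) 1) (c : ℝ) {j k : Fin n} (hjk : j < k) :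
    |c / (T k - T j) * vand β T| ≤ |c| := by
  have h1 : ∀ p : (_ : Fin n) × Fin n, |T p.2 - T p.1| ^ β ≤ 1 := fun p =>
    Real.rpow_le_one (abs_nonneg _) (abs_sub_le_one_of_mem_cube hT _ _) (by linarith)
  have h0 : ∀ p : (_ : Fin n) × Fin n, 0 ≤ |T p.2 - T p.1| ^ β := fun p =>
    Real.rpow_nonneg (abs_nonneg _) _
  have hmem : (⟨j, k⟩ : (_ : Fin n) × Fin n) ∈
      Finset.univ.sigma fun j : Fin n => Finset.Ioi j := by simpa using hjk
  rw [vand_eq_sigma, ← Finset.mul_prod_erase _ _ hmem, ← mul_assoc, abs_mul, abs_mul, abs_div,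
    abs_of_nonneg (h0 _), abs_of_nonneg (Finset.prod_nonneg fun p _ => h0 p)]
  have h2 : |T k - T j| ^ β ≤ |T k - T j| := by
    simpa using Real.rpow_le_rpow_of_exponent_ge_of_imp (abs_nonneg _)
      (abs_sub_le_one_of_mem_cube hT j k) hβ (by intro _ h; linarith)
  have h3 : |c| / |T k - T j| * |T k - T j| ^ β ≤ |c| := by
    rcases eq_or_ne |T k - T j| 0 with h | h
    · simp [h]
    · have hpos : 0 < |T k - T j| := lt_of_le_of_ne (abs_nonneg _) h.symm
      rw [div_mul_eq_mul_div, div_le_iff₀ hpos]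
      exact mul_le_mul_of_nonneg_left h2 (abs_nonneg c)
  calc _ ≤ |c| * 1 := mul_le_mul h3 (Finset.prod_le_one (fun p _ => h0 p) fun p _ => h1 p)
        (Finset.prod_nonneg fun p _ => h0 p) (abs_nonneg c)
    _ = |c| := mul_one _

lemma hasDerivAt_prod_of_log {ι : Type*} (s : Finset ι) {f : ι → ℝ → ℝ} {r : ι → ℝ} {x : ℝ}
    (h : ∀ a ∈ s, HasDerivAt (f a) (r a * f a x) x) :
    HasDerivAt (fun t => ∏ a ∈ s, f a t) ((∑ a ∈ s, r a) * ∏ a ∈ s, f a x) x := by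
  classical
  induction s using Finset.induction with
  | empty => simpa using hasDerivAt_const x (1 : ℝ)
  | insert a s ha ih =>
    simp_rw [Finset.prod_insert ha, Finset.sum_insert ha]
    refine ((h a (by simp)).mul (ih fun b hb => h b (by simp [hb]))).congr_deriv ?_
    ring

/-- The `i`-th partial derivative of the `j`-th coordinate. -/
noncomputable def coordDeriv {n : ℕ} (i j : Fin n) : ℝ := if j = i then 1 else 0

lemma hasDerivAt_update_apply {n : ℕ} (T : Fin n → ℝ) (i j : Fin n) (t : ℝ) :
    HasDerivAt (fun t => Function.update T i t j) (coordDeriv i j) t := by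
  by_cases h : j = i
  · subst h; simpa [coordDeriv] using hasDerivAt_id' t
  · simpa [coordDeriv, h] using hasDerivAt_const t (T j)

lemma hasDerivAt_pair (β : ℝ) {n : ℕ} (T : Fin n → ℝ) (i : Fin n) {j k : Fin n} (hjk : j < k)
    {t : ℝ} (ht : ∀ j, j ≠ i → T j ≠ t) :
    HasDerivAt (fun t => |Function.update T i t k - Function.update T i t j| ^ β)
      (β * (coordDeriv i k - coordDeriv i j) /
        (Function.update T i t k - Function.update T i t j) *
        |Function.update T i t k - Function.update T i t j| ^ β) t := by
  by_cases h : Function.update T i t k - Function.update T i t j = 0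
  · have hk : k ≠ i := by
      rintro rfl
      rw [Function.update_self, Function.update_of_ne hjk.ne] at h
      exact ht j hjk.ne (by linarith)
    have hj : j ≠ i := by
      rintro rfl
      rw [Function.update_self, Function.update_of_ne hjk.ne'] at h
      exact ht k hjk.ne' (by linarith)
    simp only [Function.update_of_ne hk, Function.update_of_ne hj, coordDeriv, hj, hk]
    simpa using hasDerivAt_const t (|T k - T j| ^ β)
  · have h1 := (hasDerivAt_update_apply T i k t).sub (hasDerivAt_update_apply T i j t)
    have h2 : ∀ σ : ℝ, σ * |Function.update T i t k - Function.update T i t j| =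
          Function.update T i t k - Function.update T i t j →
        HasDerivAt (|·|) σ (Function.update T i t k - Function.update T i t j) →
        HasDerivAt (fun t => |Function.update T i t k - Function.update T i t j| ^ β)
          (β * (coordDeriv i k - coordDeriv i j) /
            (Function.update T i t k - Function.update T i t j) *
            |Function.update T i t k - Function.update T i t j| ^ β) t := by
      intro σ hσ hd
      have h3 : HasDerivAt (fun t => |Function.update T i t k - Function.update T i t j|)
        (σ * (coordDeriv i k - coordDeriv i j)) t :=
        HasDerivAt.comp (h := fun t => Function.update T i t k - Function.update T i t j) t hd h1
      refine (h3.rpow_const (p := β) (Or.inl (abs_ne_zero.2 h))).congr_deriv ?_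
      rw [Real.rpow_sub_one (abs_ne_zero.2 h)]
      have h4 := abs_ne_zero.2 h
      have h5 : σ * σ = 1 := by
        have := abs_mul_abs_self (Function.update T i t k - Function.update T i t j)
        have h6 : (σ * σ - 1) * (|Function.update T i t k - Function.update T i t j| *
          |Function.update T i t k - Function.update T i t j|) = 0 := by
          linear_combination (σ * |Function.update T i t k - Function.update T i t j| +
            (Function.update T i t k - Function.update T i t j)) * hσ - this
        have := (mul_eq_zero.1 h6).resolve_right (mul_ne_zero h4 h4)
        linarith
      field_simp
      linear_combination (-(β * (coordDeriv i k - coordDeriv i j)) * σ) * hσ +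
        β * (coordDeriv i k - coordDeriv i j) *
          |Function.update T i t k - Function.update T i t j| * h5
    rcases lt_or_gt_of_ne h with h3 | h3
    · exact h2 (-1) (by rw [abs_of_neg h3]; ring) (hasDerivAt_abs_neg h3)
    · exact h2 1 (by rw [abs_of_pos h3]; ring) (hasDerivAt_abs_pos h3)

lemma hasDerivAt_chX {n : ℕ} (l : ℕ) (T : Fin n → ℝ) (i : Fin n) (t : ℝ) :
    HasDerivAt (fun t => chX l (Function.update T i t)) (4 * l * chU l t) t := by
  have h : HasDerivAt (fun t => chX l (Function.update T i t))
      (∑ j, if j = i then 4 * l * chU l t else 0) t := by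
    unfold chX
    refine HasDerivAt.fun_sum fun j _ => ?_
    by_cases h : j = i
    · subst h
      simp only [Function.update_self, if_true]
      exact ((hasDerivAt_chT l t).const_mul 2).congr_deriv (by ring)
    · simpa [h] using hasDerivAt_const t (2 * chT l (T j))
  simpa using h

lemma hasDerivAt_chXprod {n : ℕ} (S : Multiset ℕ) (T : Fin n → ℝ) (i : Fin n) (t : ℝ) :
    HasDerivAt (fun t => chXprod S (Function.update T i t))
      (msplit (fun l S => 4 * l * chU l t * chXprod S (Function.update T i t)) S) t := by
  induction S using Multiset.induction with
  | empty => simpa [chXprod_zero, msplit_zero] using hasDerivAt_const t (1 : ℝ)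
  | cons a S ih =>
    simp_rw [chXprod_cons]
    refine ((hasDerivAt_chX a T i t).mul ih).congr_deriv ?_
    rw [msplit_cons]
    simp only [msplit, mshift, chXprod_cons, ← Multiset.sum_map_mul_left, mul_left_comm]

lemma hasDerivAt_obW {α δ t : ℝ} (h0 : 0 < t) (h1 : t < 1) :
    HasDerivAt (obW α δ) ((α / t - δ / 2 / (1 - t)) * obW α δ t) t := by
  have h2 : 0 < 1 - t := by linarith
  have h := ((hasDerivAt_id' t).rpow_const (p := α) (Or.inl h0.ne')).mul
    (((hasDerivAt_id' t).const_sub 1).rpow_const (p := δ / 2) (Or.inl h2.ne'))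
  refine HasDerivAt.congr_deriv (f := obW α δ) h ?_
  rw [Real.rpow_sub_one h0.ne', Real.rpow_sub_one h2.ne', obW]
  field_simp
  ring

/-- The vector field `x (1 - x) U_{m-1}(2x - 1)` generating the loop equations. -/
noncomputable def loopV (m : ℕ) (x : ℝ) : ℝ := x * (1 - x) * chU m x

/-- The factor multiplying the weight in the `i`-th divergence term of the loop equations. -/
noncomputable def loopD (β α δ : ℝ) {n : ℕ} (m : ℕ) (S : Multiset ℕ) (i : Fin n)
    (T : Fin n → ℝ) : ℝ :=
  ((1 - 2 * T i) * chU m (T i) + T i * (1 - T i) * chU' m (T i)) * chXprod S T +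
    loopV m (T i) * msplit (fun l S => 4 * l * chU l (T i) * chXprod S T) S +
    (α * (1 - T i) - δ / 2 * T i) * chU m (T i) * chXprod S T +
    loopV m (T i) * chXprod S T *
      ∑ j, ∑ k ∈ Finset.Ioi j, β * (coordDeriv i k - coordDeriv i j) / (T k - T j)

lemma continuous_loopV (m : ℕ) : Continuous (loopV m) :=
  (continuous_id.mul (continuous_const.sub continuous_id)).mul (continuous_chU m)

lemma hasDerivAt_loopV (m : ℕ) (x : ℝ) :
    HasDerivAt (loopV m) ((1 - 2 * x) * chU m x + x * (1 - x) * chU' m x) x := by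
  refine HasDerivAt.congr_deriv (f := loopV m) (((hasDerivAt_id' x).mul
    ((hasDerivAt_id' x).const_sub 1)).mul (hasDerivAt_chU m x)) ?_
  simp only [Pi.mul_apply]
  ring

lemma continuous_msplit {X : Type*} [TopologicalSpace X] {F : X → ℕ → Multiset ℕ → ℝ}
    (hF : ∀ l S, Continuous fun x => F x l S) (S : Multiset ℕ) :
    Continuous fun x => msplit (F x) S := by
  unfold msplit
  exact continuous_multiset_sum _ fun l _ => hF l _

lemma hasDerivAt_jacW {β α δ : ℝ} {n : ℕ} (T : Fin n → ℝ) (i : Fin n) {t : ℝ}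
    (h0 : 0 < t) (h1 : t < 1) (ht : ∀ j, j ≠ i → T j ≠ t) :
    HasDerivAt (fun t => jacW β α δ n (Function.update T i t))
      (((∑ j, ∑ k ∈ Finset.Ioi j, β * (coordDeriv i k - coordDeriv i j) /
        (Function.update T i t k - Function.update T i t j)) + (α / t - δ / 2 / (1 - t))) *
        jacW β α δ n (Function.update T i t)) t := by
  have hv : HasDerivAt (fun t => vand β (Function.update T i t))
      ((∑ j, ∑ k ∈ Finset.Ioi j, β * (coordDeriv i k - coordDeriv i j) /
        (Function.update T i t k - Function.update T i t j)) *
        vand β (Function.update T i t)) t := by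
    unfold vand
    exact hasDerivAt_prod_of_log _ fun j _ => hasDerivAt_prod_of_log _ fun k hk =>
      hasDerivAt_pair β T i (by simpa using hk) ht
  have ho : HasDerivAt (fun t => ∏ j, obW α δ (Function.update T i t j))
      ((∑ j, if j = i then α / t - δ / 2 / (1 - t) else 0) *
        ∏ j, obW α δ (Function.update T i t j)) t := by
    refine hasDerivAt_prod_of_log _ fun j _ => ?_
    by_cases h : j = i
    · subst h
      simpa using hasDerivAt_obW h0 h1
    · simpa [h] using hasDerivAt_const t (obW α δ (T j))
  simp only [Finset.sum_ite_eq', Finset.mem_univ, if_true] at ho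
  simp only [jacW_eq]
  refine (hv.mul ho).congr_deriv ?_
  ring

lemma hasDerivAt_loop {β α δ : ℝ} {n : ℕ} (m : ℕ) (S : Multiset ℕ) (T : Fin n → ℝ) (i : Fin n)
    {t : ℝ} (h0 : 0 < t) (h1 : t < 1) (ht : ∀ j, j ≠ i → T j ≠ t) :
    HasDerivAt (fun t => loopV m (Function.update T i t i) * chXprod S (Function.update T i t) *
        jacW β α δ n (Function.update T i t))
      (loopD β α δ m S i (Function.update T i t) * jacW β α δ n (Function.update T i t)) t := by
  simp only [Function.update_self]
  refine (((hasDerivAt_loopV m t).mul (hasDerivAt_chXprod S T i t)).mul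
    (hasDerivAt_jacW T i h0 h1 ht)).congr_deriv ?_
  have h2 : 1 - t ≠ 0 := by linarith
  have h3 : loopV m t * (α / t - δ / 2 / (1 - t)) =
      (α * (1 - t) - δ / 2 * t) * chU m t := by
    rw [loopV]; field_simp
  simp only [loopD, Function.update_self, Pi.mul_apply]
  linear_combination (chXprod S (Function.update T i t) *
    jacW β α δ n (Function.update T i t)) * h3

lemma continuousOn_loop {β α δ : ℝ} (hβ : 0 ≤ β) (hα : -1 < α) (hδ : -2 < δ) {n : ℕ} (m : ℕ)
    (S : Multiset ℕ) (T : Fin n → ℝ) (i : Fin n) :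
    ContinuousOn (fun t => loopV m (Function.update T i t i) *
      chXprod S (Function.update T i t) * jacW β α δ n (Function.update T i t))
      (Set.Icc 0 1) := by
  have hu : Continuous fun t => Function.update T i t := continuous_const.update i continuous_id
  have h : Continuous fun t : ℝ => (t ^ (α + 1) * (1 - t) ^ (δ / 2 + 1)) * chU m t *
      (chXprod S (Function.update T i t) * vand β (Function.update T i t)) *
      ∏ j ∈ Finset.univ.erase i, obW α δ (T j) :=
    ((((continuous_id.rpow_const fun _ => Or.inr (by linarith)).mul
      ((continuous_const.sub continuous_id).rpow_const fun _ => Or.inr (by linarith))).mul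
      (continuous_chU m)).mul (((continuous_chXprod S).comp hu).mul
      ((continuous_vand hβ n).comp hu))).mul continuous_const
  refine h.continuousOn.congr fun t ht => ?_
  have e1 : t ^ (α + 1) = t ^ α * t := by
    rcases eq_or_lt_of_le ht.1 with h | h
    · rw [← h, Real.zero_rpow (by linarith), mul_zero]
    · rw [Real.rpow_add_one h.ne']
  have e2 : (1 - t) ^ (δ / 2 + 1) = (1 - t) ^ (δ / 2) * (1 - t) := by
    rcases eq_or_lt_of_le ht.2 with h | h
    · rw [h, sub_self, Real.zero_rpow (by linarith), mul_zero]
    · rw [Real.rpow_add_one (by linarith)]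
  have e3 : ∏ j, obW α δ (Function.update T i t j) =
      obW α δ t * ∏ j ∈ Finset.univ.erase i, obW α δ (T j) := by
    rw [← Finset.mul_prod_erase _ _ (Finset.mem_univ i), Function.update_self]
    congr 1
    exact Finset.prod_congr rfl fun j hj => by
      rw [Function.update_of_ne (Finset.ne_of_mem_erase hj)]
  simp only [Function.update_self, jacW_eq, e1, e2, e3, loopV]
  rw [obW]
  ring

lemma bddCube_div_mul_vand {β : ℝ} (hβ : 1 ≤ β) {n : ℕ} (c : ℝ) {j k : Fin n} (hjk : j < k) :
    BddCube fun T : Fin n → ℝ => c / (T k - T j) * vand β T := by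
  refine ⟨?_, |c|, fun T hT => abs_div_mul_vand_le hβ hT c hjk⟩
  exact (measurable_const.div ((measurable_pi_apply k).sub (measurable_pi_apply j))).mul
    (continuous_vand (by linarith) n).measurable

lemma integrableOn_loopD {β α δ : ℝ} (hβ : 1 ≤ β) (hα : -1 < α) (hδ : -2 < δ) {n : ℕ} (m : ℕ)
    (S : Multiset ℕ) (i : Fin n) :
    IntegrableOn (fun T => loopD β α δ m S i T * jacW β α δ n T) (Set.Icc 0 1) := by
  have hi : Continuous fun T : Fin n → ℝ => T i := continuous_apply i
  have hU := (continuous_chU m).comp hi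
  have hP := continuous_chXprod (n := n) S
  have hV := (continuous_loopV m).comp hi
  have h1 : Continuous fun T : Fin n → ℝ => (((1 - 2 * T i) * chU m (T i) +
      T i * (1 - T i) * chU' m (T i)) * chXprod S T +
      loopV m (T i) * msplit (fun l S => 4 * l * chU l (T i) * chXprod S T) S +
      (α * (1 - T i) - δ / 2 * T i) * chU m (T i) * chXprod S T) * vand β T := by
    have hU' := (continuous_chU' m).comp hi
    have hM : Continuous fun T : Fin n → ℝ =>
        msplit (fun l S => 4 * l * chU l (T i) * chXprod S T) S :=
      continuous_msplit (fun l S => (continuous_const.mul ((continuous_chU l).comp hi)).mul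
        (continuous_chXprod S)) S
    have hv := continuous_vand (β := β) (by linarith) n
    simp only [Function.comp_def] at hU hU' hV
    fun_prop
  have h2 : BddCube fun T : Fin n → ℝ => loopV m (T i) * chXprod S T *
      ∑ j, ∑ k ∈ Finset.Ioi j, β * (coordDeriv i k - coordDeriv i j) / (T k - T j) * vand β T :=
    (hV.mul hP).bddCube.mul (BddCube.sum _ fun j _ => BddCube.sum _ fun k hk =>
      bddCube_div_mul_vand hβ _ (by simpa using hk))
  refine ((h1.bddCube.add h2).integrableOn hα hδ).congr_fun (fun T _ => ?_) measurableSet_Icc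
  simp only [loopD, jacW_eq, ← Finset.sum_mul]
  ring

lemma setIntegral_loopD {β α δ : ℝ} (hβ : 1 ≤ β) (hα : -1 < α) (hδ : -2 < δ) {n : ℕ} (m : ℕ)
    (S : Multiset ℕ) (i : Fin n) :
    ∫ T in Set.Icc (0 : Fin n → ℝ) 1, loopD β α δ m S i T * jacW β α δ n T = 0 :=
  setIntegral_cube_eq_zero i
    (G := fun T => loopV m (T i) * chXprod S T * jacW β α δ n T)
    (integrableOn_loopD hβ hα hδ m S i)
    (fun T _ => continuousOn_loop (by linarith) hα hδ m S T i)
    (fun T => by simp [loopV]) (fun T => by simp [loopV])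
    fun T t ht hT => hasDerivAt_loop m S T i ht.1 ht.2 hT

lemma two_mul_sum_Ioi {n : ℕ} {g : Fin n → Fin n → ℝ} (hg : ∀ j k, g j k = g k j) :
    2 * ∑ j, ∑ k ∈ Finset.Ioi j, g j k = ∑ j, ∑ k, g j k - ∑ j, g j j := by
  have h1 : ∑ j, ∑ k ∈ Finset.Iio j, g j k = ∑ j, ∑ k ∈ Finset.Ioi j, g j k := by
    rw [Finset.sum_comm' (t' := Finset.univ) (s' := fun k => Finset.Ioi k) (by simp)]
    exact Finset.sum_congr rfl fun j _ => Finset.sum_congr rfl fun k _ => hg _ _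
  have h2 : ∀ j, ∑ k, g j k = ∑ k ∈ Finset.Ioi j, g j k + ∑ k ∈ Finset.Iio j, g j k + g j j := by
    intro j
    have : (Finset.univ : Finset (Fin n)) = (Finset.Ioi j ∪ Finset.Iio j) ∪ {j} := by
      ext k
      simp only [Finset.mem_univ, Finset.mem_union, Finset.mem_Ioi, Finset.mem_Iio,
        Finset.mem_singleton, true_iff]
      rcases lt_trichotomy j k with h | h | h
      · exact Or.inl (Or.inl h)
      · exact Or.inr h.symm
      · exact Or.inl (Or.inr h)
    rw [this, Finset.sum_union (by simp), Finset.sum_union, Finset.sum_singleton]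
    exact Finset.disjoint_left.2 fun k hk hk' => by
      rw [Finset.mem_Ioi] at hk
      rw [Finset.mem_Iio] at hk'
      exact lt_asymm hk hk'
  rw [Finset.sum_congr rfl fun j _ => h2 j, Finset.sum_add_distrib, Finset.sum_add_distrib, h1]
  ring

lemma sum_mul_sum_coordDeriv {n : ℕ} (β : ℝ) (V : Fin n → ℝ) (T : Fin n → ℝ) :
    ∑ i, V i * ∑ j, ∑ k ∈ Finset.Ioi j, β * (coordDeriv i k - coordDeriv i j) / (T k - T j) =
      ∑ j, ∑ k ∈ Finset.Ioi j, β * (V k - V j) / (T k - T j) := by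
  simp_rw [Finset.mul_sum]
  rw [Finset.sum_comm]
  refine Finset.sum_congr rfl fun j _ => ?_
  rw [Finset.sum_comm]
  refine Finset.sum_congr rfl fun k _ => ?_
  have h : ∀ k : Fin n, ∑ i, V i * coordDeriv i k = V k := fun k => by simp [coordDeriv]
  rw [← h k, ← h j, ← Finset.sum_sub_distrib, Finset.mul_sum, Finset.sum_div]
  refine Finset.sum_congr rfl fun i _ => ?_
  ring

lemma chX_zero {n : ℕ} (T : Fin n → ℝ) : chX 0 T = 2 * n := by
  simp [chX, chT_zero, mul_comm]

lemma pair_sum {β : ℝ} {n m : ℕ} (hm : 1 ≤ m) {T : Fin n → ℝ} (hT : Function.Injective T) :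
    -2 * ∑ j, ∑ k ∈ Finset.Ioi j, β * (loopV m (T k) - loopV m (T j)) / (T k - T j) =
      β * n / 2 * chX m T + β / 4 * ∑ k ∈ Finset.Ico 1 m, chX (m - k) T * chX k T -
        β / 2 * ∑ i, (m * chT m (T i) + (2 * T i - 1) * chU m (T i)) := by
  set g : Fin n → Fin n → ℝ := fun j k => ∑ r ∈ Finset.range m,
    (chT (m - (r + 1)) (T k) * chT (r + 1) (T j) + chT (m - (r + 1)) (T j) * chT (r + 1) (T k))
    with hg
  have h1 : ∀ j, ∀ k ∈ Finset.Ioi j, β * (loopV m (T k) - loopV m (T j)) / (T k - T j) =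
      -(β / 2) * g j k := by
    intro j k hk
    have hne : T k - T j ≠ 0 := sub_ne_zero.2 (hT.ne (Finset.mem_Ioi.1 hk).ne')
    rw [loopV, loopV, chU_pair, hg]
    field_simp
  have h2 := two_mul_sum_Ioi (g := g) fun j k => Finset.sum_congr rfl fun r _ => by ring
  have h3 : ∑ j, g j j = ∑ i, (m * chT m (T i) + (2 * T i - 1) * chU m (T i)) := by
    refine Finset.sum_congr rfl fun j _ => ?_
    rw [← sum_chT_mul_chT_self, hg, Finset.mul_sum]
    exact Finset.sum_congr rfl fun r _ => by ring
  have hX : ∀ r : ℕ, ∑ i, chT r (T i) = chX r T / 2 := fun r => by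
    rw [chX, ← Finset.mul_sum]; ring
  have h4 : ∑ j, ∑ k, g j k = (∑ r ∈ Finset.range m, chX (m - (r + 1)) T * chX (r + 1) T) / 2 := by
    have e : ∀ j k, g j k = ∑ r ∈ Finset.range m,
        (chT (m - (r + 1) : ℕ) (T k) * chT (r + 1 : ℕ) (T j) +
          chT (m - (r + 1) : ℕ) (T j) * chT (r + 1 : ℕ) (T k)) := fun j k =>
      Finset.sum_congr rfl fun r hr => by
        rw [Nat.cast_sub (Finset.mem_range.1 hr)]; push_cast; rfl
    simp_rw [e]
    rw [Finset.sum_congr rfl fun j _ => Finset.sum_comm, Finset.sum_comm, Finset.sum_div]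
    refine Finset.sum_congr rfl fun r _ => ?_
    simp_rw [Finset.sum_add_distrib, ← Finset.mul_sum, ← Finset.sum_mul, hX]
    rw [← Finset.mul_sum, hX]
    ring
  have h5 : ∑ r ∈ Finset.range m, chX (m - (r + 1)) T * chX (r + 1) T =
      ∑ k ∈ Finset.Ico 1 m, chX (m - k) T * chX k T + 2 * n * chX m T := by
    have := Finset.sum_Ico_succ_top hm fun k => chX (m - k) T * chX k T
    rw [Nat.sub_self, chX_zero] at this
    rw [← this, Finset.sum_Ico_eq_sum_range]
    simp [add_comm 1]
  rw [Finset.sum_congr rfl fun j _ => Finset.sum_congr rfl (h1 j)]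
  simp_rw [← Finset.mul_sum]
  rw [h4, h5, h3] at h2
  linear_combination (β / 2) * h2

lemma edge_sum {m : ℕ} (hm : 1 ≤ m) (p q : ℝ) {n : ℕ} (T : Fin n → ℝ) :
    ∑ i, (p * (2 * T i * chU m (T i)) - q * (2 * (1 - T i) * chU m (T i))) =
      (p + q) / 2 * chX m T + ∑ k ∈ Finset.Ico 1 m, gpar p q k * chX (m - k) T +
        n * gpar p q m := by
  have hX : ∀ r : ℕ, chX r T = 2 * ∑ i, chT r (T i) := fun r => by
    rw [chX, ← Finset.mul_sum]
  have hs : ∀ m : ℕ, ((-1 : ℝ) ^ m) * (-1) ^ m = 1 := fun m => by rw [← mul_pow]; simp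
  have h1 : ∀ i, p * (2 * T i * chU m (T i)) - q * (2 * (1 - T i) * chU m (T i)) =
      (p + q) * chT m (T i) + ∑ k ∈ Finset.Ico 1 m, gpar p q k * (2 * chT (m - k : ℕ) (T i)) +
        gpar p q m := by
    intro i
    rw [chU_edge_one hm, chU_edge_zero hm]
    have e1 : ∑ k ∈ Finset.Ico 1 m, gpar p q k * (2 * chT (m - k : ℕ) (T i)) =
        p * ∑ j ∈ Finset.Ico 1 m, 2 * chT j (T i) +
          q * ((-1) ^ m * ∑ j ∈ Finset.Ico 1 m, (-1) ^ j * (2 * chT j (T i))) := by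
      rw [Finset.mul_sum, Finset.mul_sum, Finset.mul_sum, ← Finset.sum_add_distrib]
      have hr := Finset.sum_Ico_reflect (fun j : ℕ => p * (2 * chT j (T i)) +
        q * ((-1) ^ m * ((-1) ^ j * (2 * chT j (T i))))) 1 (Nat.le_succ m)
      rw [Nat.add_sub_cancel_left, Nat.add_sub_cancel] at hr
      rw [← hr]
      refine Finset.sum_congr rfl fun k hk => ?_
      have hkm : m = (m - k) + k := by
        rw [Nat.sub_add_cancel (Finset.mem_Ico.1 hk).2.le]
      have : ((-1 : ℝ)) ^ m * (-1) ^ (m - k) = (-1) ^ k := by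
        nth_rewrite 1 [hkm]
        rw [pow_add]
        linear_combination (-1) ^ k * hs (m - k)
      rw [gpar]
      linear_combination (-(q * (2 * chT (m - k : ℕ) (T i)))) * this
    rw [e1, gpar]
    linear_combination q * chT m (T i) * hs m
  simp_rw [h1, Finset.sum_add_distrib]
  rw [Finset.sum_comm, ← Finset.mul_sum, hX]
  simp_rw [← Finset.mul_sum, hX]
  simp
  ring

lemma split_sum (m : ℕ) (S : Multiset ℕ) {n : ℕ} (T : Fin n → ℝ) :
    -2 * ∑ i, loopV m (T i) * msplit (fun l S => 4 * l * chU l (T i) * chXprod S T) S =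
      msplit (fun l S => l / 2 * (chX (m + l) T * chXprod S T -
        chX ((m : ℤ) - l).natAbs T * chXprod S T)) S := by
  simp only [msplit]
  have h : ∀ i, loopV m (T i) * (S.map fun l : ℕ =>
      4 * (l : ℝ) * chU l (T i) * chXprod (S.erase l) T).sum =
      (S.map fun l : ℕ => loopV m (T i) * (4 * (l : ℝ) * chU l (T i) *
        chXprod (S.erase l) T)).sum := fun i => by rw [Multiset.sum_map_mul_left]
  simp_rw [h]
  rw [← Multiset.sum_map_sum, ← Multiset.sum_map_mul_left]
  refine congrArg Multiset.sum (Multiset.map_congr rfl fun l _ => ?_)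
  rw [← sub_mul, chX, chX, ← Finset.sum_sub_distrib, Finset.mul_sum, Finset.sum_mul,
    Finset.mul_sum]
  refine Finset.sum_congr rfl fun i _ => ?_
  have h1 := chU_mul_chU m l (T i)
  rw [chT_natAbs, loopV]
  push_cast
  linear_combination (-(l : ℝ) * chXprod (S.erase l) T) * h1

lemma loopD_sum {β α δ p q : ℝ} (hp : p = δ / 2 + 1 / 2 - β / 4) (hq : q = α + 1 / 2 - β / 4)
    {n m : ℕ} (hm : 1 ≤ m) (S : Multiset ℕ) {T : Fin n → ℝ} (hT : Function.Injective T) :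
    -2 * ∑ i, loopD β α δ m S i T =
      (β * n / 2 + cdiag β p q m) * (chX m T * chXprod S T) +
      β / 4 * ∑ k ∈ Finset.Ico 1 m, chX k T * (chX (m - k) T * chXprod S T) +
      ∑ k ∈ Finset.Ico 1 m, gpar p q k * (chX (m - k) T * chXprod S T) +
      n * gpar p q m * chXprod S T +
      msplit (fun l S => l / 2 * (chX (m + l) T * chXprod S T -
        chX ((m : ℤ) - l).natAbs T * chXprod S T)) S := by
  have h1 := pair_sum (β := β) hm hT
  have h2 := edge_sum hm p q T
  have h3 := split_sum m S T
  rw [← sum_mul_sum_coordDeriv β (fun i => loopV m (T i)) T] at h1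
  have h4 : ∑ i, (m * chT m (T i) + (2 * T i - 1) * chU m (T i)) =
      m / 2 * chX m T + ∑ i, (2 * T i - 1) * chU m (T i) := by
    rw [Finset.sum_add_distrib, chX, ← Finset.mul_sum, ← Finset.mul_sum]
    ring
  have h5 : -2 * ∑ i, ((1 - 2 * T i) * chU m (T i) + T i * (1 - T i) * chU' m (T i)) =
      ∑ i, (m * chT m (T i) + (2 * T i - 1) * chU m (T i)) := by
    rw [Finset.mul_sum]
    exact Finset.sum_congr rfl fun i _ => chU_deriv_identity m (T i)
  have h6 : ∑ i, (p * (2 * T i * chU m (T i)) - q * (2 * (1 - T i) * chU m (T i))) =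
      (1 - β / 2) * ∑ i, (2 * T i - 1) * chU m (T i) -
        2 * ∑ i, (α * (1 - T i) - δ / 2 * T i) * chU m (T i) := by
    rw [Finset.mul_sum, Finset.mul_sum, ← Finset.sum_sub_distrib]
    refine Finset.sum_congr rfl fun i _ => ?_
    rw [hp, hq]
    ring
  have h7 : ∑ k ∈ Finset.Ico 1 m, chX k T * (chX (m - k) T * chXprod S T) =
      (∑ k ∈ Finset.Ico 1 m, chX (m - k) T * chX k T) * chXprod S T := by
    rw [Finset.sum_mul]
    exact Finset.sum_congr rfl fun k _ => by ring
  have h8 : ∑ k ∈ Finset.Ico 1 m, gpar p q k * (chX (m - k) T * chXprod S T) =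
      (∑ k ∈ Finset.Ico 1 m, gpar p q k * chX (m - k) T) * chXprod S T := by
    rw [Finset.sum_mul]
    exact Finset.sum_congr rfl fun k _ => by ring
  have h9 : ∑ i, loopD β α δ m S i T =
      (∑ i, ((1 - 2 * T i) * chU m (T i) + T i * (1 - T i) * chU' m (T i))) * chXprod S T +
      ∑ i, loopV m (T i) * msplit (fun l S => 4 * l * chU l (T i) * chXprod S T) S +
      (∑ i, (α * (1 - T i) - δ / 2 * T i) * chU m (T i)) * chXprod S T +
      (∑ i, loopV m (T i) * ∑ j, ∑ k ∈ Finset.Ioi j,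
        β * (coordDeriv i k - coordDeriv i j) / (T k - T j)) * chXprod S T := by
    rw [Finset.sum_mul, Finset.sum_mul, Finset.sum_mul, ← Finset.sum_add_distrib,
      ← Finset.sum_add_distrib, ← Finset.sum_add_distrib]
    refine Finset.sum_congr rfl fun i _ => ?_
    rw [loopD]
    ring
  rw [h9, h7, h8, ← h3, cdiag]
  linear_combination chXprod S T * (h1 + h2 + h5 - h6 + (1 - β / 2) * h4)

lemma integrableOn_mul_jacW {β α δ : ℝ} (hβ : 0 ≤ β) (hα : -1 < α) (hδ : -2 < δ) {n : ℕ}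
    {f : (Fin n → ℝ) → ℝ} (hf : Continuous f) :
    IntegrableOn (fun T => f T * jacW β α δ n T) (Set.Icc 0 1) := by
  refine ((hf.mul (continuous_vand hβ n)).bddCube.integrableOn hα hδ).congr_fun
    (fun T _ => ?_) measurableSet_Icc
  simp only [jacW_eq, Pi.mul_apply, mul_assoc]

lemma jacW_nonneg (β α δ : ℝ) {n : ℕ} {T : Fin n → ℝ} (hT : T ∈ Set.Icc (0 : Fin n → ℝ) 1) :
    0 ≤ jacW β α δ n T := by
  rw [jacW_eq]
  exact mul_nonneg (vand_nonneg β T) (Finset.prod_nonneg fun j _ =>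
    obW_nonneg α δ (hT.1 j) (hT.2 j))

lemma jacW_eq_zero {β α δ : ℝ} (hβ : β ≠ 0) {n : ℕ} {T : Fin n → ℝ}
    (hT : ¬ Function.Injective T) : jacW β α δ n T = 0 := by
  have h : ∃ j k, j < k ∧ T j = T k := by
    simp only [Function.Injective, not_forall] at hT
    obtain ⟨j, k, h1, h2⟩ := hT
    rcases lt_or_gt_of_ne h2 with h | h
    · exact ⟨j, k, h, h1⟩
    · exact ⟨k, j, h, h1.symm⟩
  obtain ⟨j, k, hjk, h⟩ := h
  have : vand β T = 0 := Finset.prod_eq_zero (Finset.mem_univ j)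
    (Finset.prod_eq_zero (Finset.mem_Ioi.2 hjk) (by simp [h, Real.zero_rpow hβ]))
  rw [jacW_eq, this, zero_mul]

/-- The function `f` is integrable on the unit cube, with integral `c`. -/
def HasCubeIntegral {n : ℕ} (f : (Fin n → ℝ) → ℝ) (c : ℝ) : Prop :=
  IntegrableOn f (Set.Icc 0 1) ∧ ∫ T in Set.Icc (0 : Fin n → ℝ) 1, f T = c

lemma HasCubeIntegral.add {n : ℕ} {f g : (Fin n → ℝ) → ℝ} {a b : ℝ} (hf : HasCubeIntegral f a)
    (hg : HasCubeIntegral g b) : HasCubeIntegral (fun T => f T + g T) (a + b) :=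
  ⟨hf.1.add hg.1, by rw [integral_add hf.1 hg.1, hf.2, hg.2]⟩

lemma HasCubeIntegral.sub {n : ℕ} {f g : (Fin n → ℝ) → ℝ} {a b : ℝ} (hf : HasCubeIntegral f a)
    (hg : HasCubeIntegral g b) : HasCubeIntegral (fun T => f T - g T) (a - b) :=
  ⟨hf.1.sub hg.1, by rw [integral_sub hf.1 hg.1, hf.2, hg.2]⟩

lemma HasCubeIntegral.const_mul {n : ℕ} {f : (Fin n → ℝ) → ℝ} {a : ℝ} (hf : HasCubeIntegral f a)
    (c : ℝ) : HasCubeIntegral (fun T => c * f T) (c * a) :=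
  ⟨hf.1.const_mul c, by rw [integral_const_mul, hf.2]⟩

lemma HasCubeIntegral.sum {n : ℕ} {ι : Type*} (s : Finset ι) {f : ι → (Fin n → ℝ) → ℝ} {a : ι → ℝ}
    (hf : ∀ i ∈ s, HasCubeIntegral (f i) (a i)) :
    HasCubeIntegral (fun T => ∑ i ∈ s, f i T) (∑ i ∈ s, a i) :=
  ⟨integrable_finsetSum _ fun i hi => (hf i hi).1, by
    rw [integral_finsetSum _ fun i hi => (hf i hi).1]
    exact Finset.sum_congr rfl fun i hi => (hf i hi).2⟩

lemma HasCubeIntegral.multiset_sum {n : ℕ} {ι : Type*} (S : Multiset ι)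
    {f : ι → (Fin n → ℝ) → ℝ} {a : ι → ℝ} (hf : ∀ i, HasCubeIntegral (f i) (a i)) :
    HasCubeIntegral (fun T => (S.map fun i => f i T).sum) (S.map a).sum := by
  induction S using Multiset.induction with
  | empty => exact ⟨by simp, by simp⟩
  | cons i S ih => simpa using (hf i).add ih

/-- The moments of the Chebyshev linear statistics of the Jacobi ensemble, exponentially tilted
by the first two of them. -/
noncomputable def jacMom (β α δ : ℝ) (n : ℕ) (s t : ℝ) (S : Multiset ℕ) : ℝ :=
  ∫ T in Set.Icc (0 : Fin n → ℝ) 1,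
    chXprod S T * Real.exp (s * chX 1 T + t * chX 2 T) * jacW β α δ n T

lemma hasCubeIntegral_jacMom {β α δ : ℝ} (hβ : 0 ≤ β) (hα : -1 < α) (hδ : -2 < δ) (n : ℕ)
    (s t : ℝ) (S : Multiset ℕ) :
    HasCubeIntegral
      (fun T => chXprod S T * Real.exp (s * chX 1 T + t * chX 2 T) * jacW β α δ n T)
      (jacMom β α δ n s t S) :=
  ⟨integrableOn_mul_jacW hβ hα hδ ((continuous_chXprod S).mul
    (((continuous_const.mul (continuous_chX 1)).add
      (continuous_const.mul (continuous_chX 2))).rexp)), rfl⟩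

lemma jacMom_zero_pos {β α δ : ℝ} (hβ : 0 ≤ β) (hα : -1 < α) (hδ : -2 < δ) (n : ℕ) (s t : ℝ) :
    0 < jacMom β α δ n s t 0 := by
  have hi := (hasCubeIntegral_jacMom hβ hα hδ n s t 0).1
  rw [jacMom, setIntegral_pos_iff_support_of_nonneg_ae _ hi]
  · set a : Fin n → ℝ := fun i => i / (n + 1) with ha
    set b : Fin n → ℝ := fun i => (i + 1) / (n + 1) with hb
    have hn : (0 : ℝ) < n + 1 := by positivity
    have hpos : 0 < volume (Set.pi Set.univ fun i => Set.Ioo (a i) (b i)) := by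
      refine (isOpen_set_pi Set.finite_univ fun i _ => isOpen_Ioo).measure_pos _
        (Set.univ_pi_nonempty_iff.2 fun i => Set.nonempty_Ioo.2 ?_)
      simp only [ha, hb]
      gcongr
      linarith
    refine hpos.trans_le (measure_mono fun T hT => ?_)
    have hT' : ∀ i, a i < T i ∧ T i < b i := fun i => hT i (Set.mem_univ i)
    have h0 : ∀ i, 0 < T i := fun i => lt_of_le_of_lt (by simp only [ha]; positivity) (hT' i).1
    have h1 : ∀ i, T i < 1 := fun i => (hT' i).2.trans (by
      simp only [hb]
      rw [div_lt_one hn]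
      have : ((i : ℕ) : ℝ) < n := by exact_mod_cast i.2
      linarith)
    have hmono : StrictMono T := fun i j hij => by
      have : b i ≤ a j := by
        simp only [ha, hb]
        have : ((i : ℕ) : ℝ) + 1 ≤ (j : ℕ) := by exact_mod_cast hij
        gcongr
      exact ((hT' i).2.trans_le this).trans (hT' j).1
    refine ⟨?_, fun i => (h0 i).le, fun i => (h1 i).le⟩
    rw [Function.mem_support, chXprod_zero, one_mul, jacW_eq]
    refine mul_ne_zero (Real.exp_ne_zero _) (mul_ne_zero ?_ ?_)
    · exact Finset.prod_ne_zero_iff.2 fun j _ => Finset.prod_ne_zero_iff.2 fun k hk =>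
        (Real.rpow_pos_of_pos (abs_pos.2 (sub_ne_zero.2
          (hmono (Finset.mem_Ioi.1 hk)).ne')) _).ne'
    · exact Finset.prod_ne_zero_iff.2 fun j _ => (mul_pos (Real.rpow_pos_of_pos (h0 j) _)
        (Real.rpow_pos_of_pos (by linarith [h1 j]) _)).ne'
  · refine (ae_restrict_iff' measurableSet_Icc).2 (.of_forall fun T hT => ?_)
    simp only [chXprod_zero, one_mul]
    exact mul_nonneg (Real.exp_nonneg _) (jacW_nonneg β α δ hT)

lemma abs_chX_le {n : ℕ} (m : ℕ) {T : Fin n → ℝ} (hT : T ∈ Set.Icc (0 : Fin n → ℝ) 1) :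
    |chX m T| ≤ 2 * n := by
  refine (Finset.abs_sum_le_sum_abs _ _).trans ?_
  refine (Finset.sum_le_card_nsmul _ _ 2 fun i _ => ?_).trans_eq (by simp [mul_comm])
  rw [abs_mul, abs_two]
  linarith [abs_chT_le_one m (hT.1 i) (hT.2 i)]

lemma abs_chXprod_le {n : ℕ} (S : Multiset ℕ) {T : Fin n → ℝ}
    (hT : T ∈ Set.Icc (0 : Fin n → ℝ) 1) : |chXprod S T| ≤ (2 * n) ^ S.card := by
  induction S using Multiset.induction with
  | empty => simp [chXprod_zero]
  | cons a S ih =>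
    rw [chXprod_cons, abs_mul, Multiset.card_cons, pow_succ']
    exact mul_le_mul (abs_chX_le a hT) ih (abs_nonneg _) (by positivity)

lemma abs_jacMom_le {β α δ : ℝ} (hβ : 0 ≤ β) (hα : -1 < α) (hδ : -2 < δ) (n : ℕ) (s t : ℝ)
    (S : Multiset ℕ) : |jacMom β α δ n s t S| ≤ (2 * n) ^ S.card * jacMom β α δ n s t 0 := by
  have h0 := hasCubeIntegral_jacMom hβ hα hδ n s t 0
  have hS := hasCubeIntegral_jacMom hβ hα hδ n s t S
  rw [← (h0.const_mul ((2 * n) ^ S.card)).2, ← hS.2]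
  refine (abs_integral_le_integral_abs).trans ?_
  refine setIntegral_mono_on hS.1.abs (h0.const_mul _).1 measurableSet_Icc fun T hT => ?_
  rw [abs_mul, abs_mul, chXprod_zero, one_mul, mul_assoc, abs_of_nonneg (Real.exp_nonneg _),
    abs_of_nonneg (jacW_nonneg β α δ hT)]
  exact mul_le_mul_of_nonneg_right (abs_chXprod_le S hT)
    (mul_nonneg (Real.exp_nonneg _) (jacW_nonneg β α δ hT))

lemma jacMom_momentLoop {β α δ p q : ℝ} (hβ : 1 ≤ β) (hα : -1 < α) (hδ : -2 < δ)
    (hp : p = δ / 2 + 1 / 2 - β / 4) (hq : q = α + 1 / 2 - β / 4) (n : ℕ) :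
    MomentLoop β p q n (jacMom β α δ n 0 0) := by
  have hZ : ∀ S, HasCubeIntegral (fun T => chXprod S T * jacW β α δ n T)
      (jacMom β α δ n 0 0 S) := fun S => by
    simpa using hasCubeIntegral_jacMom (by linarith) hα hδ n 0 0 S
  refine ⟨(jacMom_zero_pos (by linarith) hα hδ n 0 0).ne', ?_, fun m hm => ?_⟩
  · funext S
    have h := (hZ S).const_mul (2 * n)
    rw [Pi.smul_apply, smul_eq_mul, ← h.2, mshift, ← (hZ (0 ::ₘ S)).2]
    simp_rw [chXprod_cons, chX_zero, mul_assoc]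
  · funext S
    have hD : HasCubeIntegral (fun T => -2 * ∑ i, loopD β α δ m S i T * jacW β α δ n T)
        (-2 * ∑ i : Fin n, 0) :=
      (HasCubeIntegral.sum _ fun i _ => ⟨integrableOn_loopD hβ hα hδ m S i,
        setIntegral_loopD hβ hα hδ m S i⟩).const_mul _
    rw [Finset.sum_const_zero, mul_zero] at hD
    have hR := (((((hZ (m ::ₘ S)).const_mul (β * n / 2 + cdiag β p q m)).add
      ((HasCubeIntegral.sum (Finset.Ico 1 m)
        fun k _ => hZ (k ::ₘ (m - k) ::ₘ S)).const_mul (β / 4))).add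
      (HasCubeIntegral.sum (Finset.Ico 1 m)
        fun k _ => (hZ ((m - k) ::ₘ S)).const_mul (gpar p q k))).add
      ((hZ S).const_mul (n * gpar p q m))).add
      (HasCubeIntegral.multiset_sum S fun l : ℕ => ((hZ ((m + l) ::ₘ S.erase l)).sub
        (hZ (((m : ℤ) - l).natAbs ::ₘ S.erase l))).const_mul ((l : ℝ) / 2))
    have key := hR.2.symm.trans (Eq.trans (integral_congr_ae (.of_forall fun T => ?_)) hD.2)
    · simpa [mshift, msplit, Finset.sum_apply] using key
    · by_cases hT : Function.Injective T
      · have h := loopD_sum hp hq hm S hT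
        simp only [← Finset.sum_mul, ← mul_assoc (-2 : ℝ)]
        rw [h]
        simp only [chXprod_cons, msplit, add_mul, Finset.sum_mul, Finset.mul_sum, mul_assoc,
          ← Multiset.sum_map_mul_right, sub_mul]
      · simp [jacW_eq_zero (by linarith : β ≠ 0) hT]

lemma hasDerivAt_multiset_sum {ι : Type*} (S : Multiset ι) {f : ℝ → ι → ℝ} {f' : ι → ℝ} {u : ℝ}
    (hf : ∀ i ∈ S, HasDerivAt (fun v => f v i) (f' i) u) :
    HasDerivAt (fun v => (S.map (f v)).sum) (S.map f').sum u := by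
  induction S using Multiset.induction with
  | empty => simpa using hasDerivAt_const u (0 : ℝ)
  | cons i S ih =>
    simpa using (hf i (Multiset.mem_cons_self i S)).fun_add
      (ih fun j hj => hf j (Multiset.mem_cons_of_mem hj))

lemma hasDerivAt_mconv {f g : ℝ → Multiset ℕ → ℝ} {f' g' : Multiset ℕ → ℝ} {u : ℝ}
    (hf : ∀ S, HasDerivAt (fun v => f v S) (f' S) u)
    (hg : ∀ S, HasDerivAt (fun v => g v S) (g' S) u) (S : Multiset ℕ) :
    HasDerivAt (fun v => mconv (f v) (g v) S) ((mconv f' (g u) + mconv (f u) g') S) u := by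
  have h := hasDerivAt_multiset_sum S.antidiagonal
    (f := fun v (p : Multiset ℕ × Multiset ℕ) => f v p.1 * g v p.2)
    (f' := fun p => f' p.1 * g u p.2 + f u p.1 * g' p.2) (u := u)
    fun p _ => (hf p.1).mul (hg p.2)
  rwa [Multiset.sum_map_add] at h

lemma differentiableAt_mquo {Z g : ℝ → Multiset ℕ → ℝ} {u : ℝ} (hZ0 : Z u 0 ≠ 0)
    (hZ : ∀ S, DifferentiableAt ℝ (fun v => Z v S) u)
    (hg : ∀ S, DifferentiableAt ℝ (fun v => g v S) u) (S : Multiset ℕ) :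
    DifferentiableAt ℝ (fun v => mquo (Z v) (g v) S) u := by
  induction S using Multiset.strongInductionOn with
  | _ S ih =>
    simp_rw [mquo_eq _ _ S]
    refine ((hg S).sub ?_).div (hZ 0) hZ0
    exact (hasDerivAt_multiset_sum (properAnti S) fun p hp =>
      ((ih p.1 (lt_of_mem_properAnti hp)).mul (hZ p.2)).hasDerivAt).differentiableAt

lemma hasDerivAt_mcum {Z : ℝ → Multiset ℕ → ℝ} {c : ℝ} {r : ℕ} {u : ℝ} (hZ0 : ∀ v, Z v 0 ≠ 0)
    (hZ : ∀ S, HasDerivAt (fun v => Z v S) (c * Z u (r ::ₘ S)) u) (m : ℕ) (S : Multiset ℕ) :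
    HasDerivAt (fun v => mcum (Z v) m S) (c * mcum (Z u) m (r ::ₘ S)) u := by
  have hd : ∀ S, HasDerivAt (fun v => mcum (Z v) m S) (deriv (fun v => mcum (Z v) m S) u) u :=
    fun S => (differentiableAt_mquo (hZ0 u) (fun S => (hZ S).differentiableAt)
      (fun S => (hZ (m ::ₘ S)).differentiableAt) S).hasDerivAt
  have key : (fun S => deriv (fun v => mcum (Z v) m S) u) = c • mshift r (mcum (Z u) m) := by
    refine mconv_right_cancel (hZ0 u) (funext fun S => ?_)
    have h1 := hasDerivAt_mconv hd (g' := c • mshift r (Z u)) hZ S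
    simp_rw [mcum_mconv (hZ0 _) m] at h1
    have h2 := h1.unique (hZ (m ::ₘ S))
    have h3 := congrFun (congrArg (mshift r) (mcum_mconv (hZ0 u) m)) S
    rw [mshift_mconv] at h3
    rw [mconv_smul_right] at h2
    rw [mconv_smul_left]
    simp only [Pi.add_apply, Pi.smul_apply, smul_eq_mul, mshift] at h2 h3 ⊢
    rw [Multiset.cons_swap] at h2
    rw [← h3] at h2
    linarith
  have := congrFun key S
  simp only [Pi.smul_apply, smul_eq_mul, mshift] at this
  rw [← this]
  exact hd S

lemma hasDerivAt_log_mcum {Z : ℝ → Multiset ℕ → ℝ} {c : ℝ} {r : ℕ} {u : ℝ} (hZ0 : Z u 0 ≠ 0)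
    (hZ : HasDerivAt (fun v => Z v 0) (c * Z u (r ::ₘ 0)) u) :
    HasDerivAt (fun v => Real.log (Z v 0)) (c * mcum (Z u) r 0) u := by
  have h := congrFun (mcum_mconv hZ0 r) 0
  rw [mconv_zero, mshift] at h
  convert hZ.log hZ0 using 1
  rw [← h]
  field_simp

lemma hasDerivAt_integral_tilt {β α δ : ℝ} (hβ : 0 ≤ β) (hα : -1 < α) (hδ : -2 < δ) {n : ℕ}
    {f h c : (Fin n → ℝ) → ℝ} (hf : Continuous f) (hh : Continuous h) (hc : Continuous c) (u : ℝ) :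
    HasDerivAt
      (fun v => ∫ T in Set.Icc (0 : Fin n → ℝ) 1, f T * Real.exp (v * h T + c T) * jacW β α δ n T)
      (∫ T in Set.Icc (0 : Fin n → ℝ) 1,
        h T * f T * Real.exp (u * h T + c T) * jacW β α δ n T) u := by
  have hexp : ∀ v : ℝ, Continuous fun T => Real.exp (v * h T + c T) := fun v =>
    ((continuous_const.mul hh).add hc).rexp
  have hint : ∀ v : ℝ, IntegrableOn (fun T => f T * Real.exp (v * h T + c T) * jacW β α δ n T)
      (Set.Icc 0 1) := fun v => integrableOn_mul_jacW hβ hα hδ (hf.mul (hexp v))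
  have hbd : Continuous fun T => |h T * f T| * Real.exp ((|u| + 1) * |h T| + c T) :=
    (hh.mul hf).abs.mul ((continuous_const.mul hh.abs).add hc).rexp
  refine (hasDerivAt_integral_of_dominated_loc_of_deriv_le
    (F' := fun v T => h T * f T * Real.exp (v * h T + c T) * jacW β α δ n T)
    (bound := fun T => |h T * f T| * Real.exp ((|u| + 1) * |h T| + c T) * jacW β α δ n T)
    (Metric.ball_mem_nhds u one_pos) (.of_forall fun v => (hint v).aestronglyMeasurable) (hint u)
    (integrableOn_mul_jacW hβ hα hδ ((hh.mul hf).mul (hexp u))).aestronglyMeasurable ?_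
    (integrableOn_mul_jacW hβ hα hδ hbd) (.of_forall fun T v _ => ?_)).2
  · refine (ae_restrict_iff' measurableSet_Icc).2 (.of_forall fun T hT v hv => ?_)
    have hv' : |v| ≤ |u| + 1 := by
      have h1 : |v - u| < 1 := by simpa [Real.dist_eq] using hv
      have h2 := abs_add_le (v - u) u
      rw [sub_add_cancel] at h2
      linarith
    rw [Real.norm_eq_abs, abs_mul, abs_mul, abs_of_nonneg (Real.exp_nonneg _),
      abs_of_nonneg (jacW_nonneg β α δ hT)]
    refine mul_le_mul_of_nonneg_right (mul_le_mul_of_nonneg_left (Real.exp_le_exp.2 ?_)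
      (abs_nonneg _)) (jacW_nonneg β α δ hT)
    have h3 : v * h T ≤ |v| * |h T| := (le_abs_self _).trans_eq (abs_mul _ _)
    have h4 := mul_le_mul_of_nonneg_right hv' (abs_nonneg (h T))
    linarith
  · have h1 : HasDerivAt (fun v => v * h T + c T) (h T) v := by
      simpa using ((hasDerivAt_id v).mul_const (h T)).add_const (c T)
    exact (((h1.exp.const_mul (f T)).mul_const (jacW β α δ n T))).congr_deriv (by ring)

/-- The moments tilted by conductance and shot noise. -/
noncomputable def condMom (β α δ : ℝ) (n : ℕ) (z w : ℝ) : Multiset ℕ → ℝ :=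
  jacMom β α δ n (-z / 4) (w / 16)

lemma condMom_zero_ne {β α δ : ℝ} (hβ : 0 ≤ β) (hα : -1 < α) (hδ : -2 < δ) (n : ℕ) (z w : ℝ) :
    condMom β α δ n z w 0 ≠ 0 := (jacMom_zero_pos hβ hα hδ n _ _).ne'

lemma hasDerivAt_condMom_left {β α δ : ℝ} (hβ : 0 ≤ β) (hα : -1 < α) (hδ : -2 < δ) (n : ℕ)
    (z w : ℝ) (S : Multiset ℕ) :
    HasDerivAt (fun v => condMom β α δ n v w S) ((-1 / 4) * condMom β α δ n z w (1 ::ₘ S)) z := by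
  have h := (hasDerivAt_integral_tilt hβ hα hδ (continuous_chXprod (n := n) S) (continuous_chX 1)
    (continuous_const.mul (continuous_chX 2) (f := fun _ => w / 16)) (-z / 4)).comp z
    ((hasDerivAt_id z).neg.div_const 4)
  rw [mul_comm]
  simp only [condMom, jacMom, chXprod_cons]
  exact h

lemma hasDerivAt_condMom_right {β α δ : ℝ} (hβ : 0 ≤ β) (hα : -1 < α) (hδ : -2 < δ) (n : ℕ)
    (z w : ℝ) (S : Multiset ℕ) :
    HasDerivAt (fun v => condMom β α δ n z v S) ((1 / 16) * condMom β α δ n z w (2 ::ₘ S)) w := by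
  have h := (hasDerivAt_integral_tilt hβ hα hδ (continuous_chXprod (n := n) S) (continuous_chX 2)
    (continuous_const.mul (continuous_chX 1) (f := fun _ => -z / 4)) (w / 16)).comp w
    ((hasDerivAt_id w).div_const 16)
  rw [mul_comm]
  simp only [condMom, jacMom, chXprod_cons, add_comm (-z / 4 * _)]
  exact h

lemma sigJoint_eq {β α δ : ℝ} (hβ : 0 ≤ β) (hα : -1 < α) (hδ : -2 < δ) (n : ℕ) (z w : ℝ) :
    sigJoint β α δ n z w = Real.log (condMom β α δ n z w 0) +
      ((-(n / 8)) * w + ((-(n / 2)) * z - Real.log (cSel β α δ n))) := by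
  have hM : (∫ T in Set.Icc (0 : Fin n → ℝ) 1,
      Real.exp (∑ j, (-(z * T j) - w * T j * (1 - T j))) * jacW β α δ n T) =
      Real.exp (-(n / 2) * z - (n / 8) * w) * condMom β α δ n z w 0 := by
    rw [condMom, jacMom, ← integral_const_mul]
    refine integral_congr_ae (.of_forall fun T => ?_)
    simp only [chXprod_zero, one_mul]
    rw [← mul_assoc, ← Real.exp_add]
    congr 2
    have h2 : ∀ x, chT 2 x = 2 * (2 * x - 1) ^ 2 - 1 := fun x => by simp [chT, Polynomial.Chebyshev.T_two]
    have hc : ∀ c : ℝ, (n : ℝ) * c = ∑ _ : Fin n, c := fun c => by simp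
    have hn : -((n : ℝ) / 2) * z - n / 8 * w = n * (-(1 / 2) * z - 1 / 8 * w) := by ring
    rw [hn, hc, chX, chX, Finset.mul_sum, Finset.mul_sum, ← Finset.sum_add_distrib,
      ← Finset.sum_add_distrib]
    refine Finset.sum_congr rfl fun j _ => ?_
    simp only [Nat.cast_one, Nat.cast_ofNat, chT_one, h2]
    ring
  have hc : cSel β α δ n ≠ 0 := by
    have h := (jacMom_zero_pos hβ hα hδ n 0 0).ne'
    simpa [jacMom, chXprod_zero, cSel] using h
  have hZ := condMom_zero_ne hβ hα hδ n z w
  rw [sigJoint, Mjoint, hM, Real.log_div (mul_ne_zero (Real.exp_ne_zero _) hZ) hc,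
    Real.log_mul (Real.exp_ne_zero _) hZ, Real.log_exp]
  ring

lemma iteratedDeriv_eq_of_hasDerivAt {F : ℕ → ℝ → ℝ}
    (hF : ∀ j x, HasDerivAt (F j) (F (j + 1) x) x) (k : ℕ) : iteratedDeriv k (F 0) = F k := by
  induction k with
  | zero => exact iteratedDeriv_zero
  | succ k ih => rw [iteratedDeriv_succ, ih]; exact funext fun x => (hF k x).deriv

/-- Successive derivatives of a function whose first derivative is `mcum` up to a constant. -/
lemma iteratedDeriv_log_add {Z : ℝ → Multiset ℕ → ℝ} {c : ℝ} {r : ℕ} (hZ0 : ∀ v, Z v 0 ≠ 0)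
    (hZ : ∀ v S, HasDerivAt (fun v => Z v S) (c * Z v (r ::ₘ S)) v) (a b : ℝ) (k : ℕ) (x : ℝ) :
    iteratedDeriv (k + 1) (fun v => Real.log (Z v 0) + (a * v + b)) x =
      c ^ (k + 1) * mcum (Z x) r (Multiset.replicate k r) + if k = 0 then a else 0 := by
  let F : ℕ → ℝ → ℝ := fun j v => match j with
    | 0 => Real.log (Z v 0) + (a * v + b)
    | j + 1 => c ^ (j + 1) * mcum (Z v) r (Multiset.replicate j r) + if j = 0 then a else 0
  refine congrFun (iteratedDeriv_eq_of_hasDerivAt (F := F) (fun j v => ?_) (k + 1)) x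
  cases j with
  | zero =>
    have h := (hasDerivAt_log_mcum (hZ0 v) (hZ v 0)).fun_add
      (((hasDerivAt_id v).const_mul a).add_const b)
    simpa [F] using h
  | succ j =>
    have h := ((hasDerivAt_mcum hZ0 (hZ v) r (Multiset.replicate j r)).const_mul
      (c ^ (j + 1))).add_const (if j = 0 then a else 0)
    refine h.congr_deriv ?_
    simp only [F, Multiset.replicate_succ, Nat.succ_ne_zero, if_false]
    ring

lemma iteratedDeriv_mcum_add {Z : ℝ → Multiset ℕ → ℝ} {c : ℝ} {r : ℕ} (hZ0 : ∀ v, Z v 0 ≠ 0)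
    (hZ : ∀ v S, HasDerivAt (fun v => Z v S) (c * Z v (r ::ₘ S)) v) (m : ℕ) (S : Multiset ℕ)
    (a b : ℝ) (k : ℕ) (x : ℝ) :
    iteratedDeriv (k + 1) (fun v => a * mcum (Z v) m S + b) x =
      a * c ^ (k + 1) * mcum (Z x) m (Multiset.replicate (k + 1) r + S) := by
  let F : ℕ → ℝ → ℝ := fun j v =>
    a * c ^ j * mcum (Z v) m (Multiset.replicate j r + S) + if j = 0 then b else 0
  have h := congrFun (iteratedDeriv_eq_of_hasDerivAt (F := F) (fun j v => ?_) (k + 1)) x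
  · simpa [F] using h
  · have h := ((hasDerivAt_mcum hZ0 (hZ v) m (Multiset.replicate j r + S)).const_mul
      (a * c ^ j)).add_const (if j = 0 then b else 0)
    refine h.congr_deriv ?_
    simp only [F, Multiset.replicate_succ, Multiset.cons_add, Nat.succ_ne_zero, if_false]
    ring

lemma kappaJ_zero_right {β α δ : ℝ} (hβ : 0 ≤ β) (hα : -1 < α) (hδ : -2 < δ) (l n : ℕ) :
    kappaJ β α δ (l + 2) 0 n =
      (1 / 4) ^ (l + 2) * mcum (jacMom β α δ n 0 0) 1 (Multiset.replicate (l + 1) 1) := by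
  have h := iteratedDeriv_log_add (fun v => condMom_zero_ne hβ hα hδ n v 0)
    (fun v => hasDerivAt_condMom_left hβ hα hδ n v 0) (-(n / 2)) (- Real.log (cSel β α δ n))
    (l + 1) 0
  simp only [kappaJ, iteratedDeriv_zero, sigJoint_eq hβ hα hδ, mul_zero, zero_add, sub_eq_add_neg]
  rw [h]
  simp only [condMom, neg_zero, zero_div, Nat.succ_ne_zero, if_false, add_zero, ← mul_assoc,
    ← mul_pow]
  norm_num

lemma kappaJ_succ_succ {β α δ : ℝ} (hβ : 0 ≤ β) (hα : -1 < α) (hδ : -2 < δ) (l k n : ℕ) :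
    kappaJ β α δ (l + 1) (k + 1) n = (1 / 4) ^ (l + 1) * (-1 / 16) ^ (k + 1) *
      mcum (jacMom β α δ n 0 0) 2 (Multiset.replicate (l + 1) 1 + Multiset.replicate k 2) := by
  have h : ∀ z, iteratedDeriv (k + 1) (fun w => sigJoint β α δ n z w) 0 =
      (1 / 16) ^ (k + 1) * mcum (condMom β α δ n z 0) 2 (Multiset.replicate k 2) +
        if k = 0 then -((n : ℝ) / 8) else 0 := fun z => by
    simp only [sigJoint_eq hβ hα hδ]
    exact iteratedDeriv_log_add (fun v => condMom_zero_ne hβ hα hδ n z v)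
      (fun v => hasDerivAt_condMom_right hβ hα hδ n z v) _ _ k 0
  rw [kappaJ]
  simp only [h]
  rw [iteratedDeriv_mcum_add (fun v => condMom_zero_ne hβ hα hδ n v 0)
    (fun v => hasDerivAt_condMom_left hβ hα hδ n v 0)]
  have h1 : ((-1 : ℝ) / 4) = -1 * (1 / 4) := by norm_num
  have h2 : ((-1 : ℝ) / 16) = -1 * (1 / 16) := by norm_num
  have h3 : ((-1 : ℝ) ^ (l + 1)) * (-1) ^ (l + 1) = 1 := by rw [← mul_pow]; norm_num
  simp only [condMom, neg_zero, zero_div]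
  rw [h1, h2, mul_pow, mul_pow, pow_add]
  linear_combination ((-1 : ℝ) ^ (k + 1) * (1 / 4) ^ (l + 1) * (1 / 16) ^ (k + 1) *
    mcum (jacMom β α δ n 0 0) 2 (Multiset.replicate (l + 1) 1 + Multiset.replicate k 2)) * h3

/-- Weak localization limit of the mixed cumulants of conductance and shot noise,
odd `l`, for `β ∈ {1,4}`. -/
theorem weak_localization_odd_mixed_cumulants
    (β α δ : ℝ) (hβ : β = 1 ∨ β = 4) (hα : -1 < α) (hδ : -2 < δ)
    (l k : ℕ) (hl : Odd l) (hlk : (l, k) ≠ (1, 0)) :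
    Tendsto (fun n : ℕ => (n : ℝ) ^ (l + k) * kappaJ β α δ l k n) atTop
      (nhds ((δ / 2 - α) * (α + δ / 2 + 2 - β) * (Nat.factorial (k + l - 1) : ℝ) /
        (β * (2 * β) ^ l * (4 * β) ^ k))) := by
  have hβ1 : 1 ≤ β := by rcases hβ with h | h <;> rw [h]; norm_num
  have hβ0 : 0 ≤ β := by linarith
  have hβne : β ≠ 0 := by linarith
  have hlim : ∀ {m : ℕ} {S : Multiset ℕ}, 1 ≤ m → MPos S → S ≠ 0 → Odd (m + S.sum) → _ :=
    fun {m S} hm hS hS0 ho => tendsto_mcum_of_odd hβne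
      (jacMom_momentLoop hβ1 hα hδ rfl rfl)
      (fun n S => abs_jacMom_le hβ0 hα hδ n 0 0 S) (m := m) (S := S) hm hS hS0 ho
  rcases k with _ | k
  · obtain ⟨j, rfl⟩ : ∃ j, l = 2 * j + 2 + 1 := by
      obtain ⟨j, rfl⟩ := hl
      rcases j with _ | j
      · simp at hlk
      · exact ⟨j, by ring⟩
    have h := (hlim (m := 1) (S := Multiset.replicate (2 * j + 2) 1) le_rfl
      (fun x hx => (Multiset.eq_of_mem_replicate hx).ge) (by simp [Multiset.replicate_succ])
      (by simp; grind)).const_mul ((1 / 4 : ℝ) ^ (2 * j + 2 + 1))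
    have hk := kappaJ_zero_right hβ0 hα hδ (2 * j + 1)
    simp only [Multiset.card_replicate, Multiset.prod_replicate] at h
    convert h using 1
    · funext n
      rw [show 2 * j + 2 + 1 = 2 * j + 1 + 2 from rfl, hk]
      ring_nf
    · congr 1
      have hs : (-1 : ℝ) ^ (2 * j + 2) = 1 := Even.neg_one_pow (by grind)
      rw [oddConst, show 0 + (2 * j + 2 + 1) - 1 = 2 * j + 2 from by omega, neg_pow, hs]
      simp only [div_pow, mul_pow, pow_succ, pow_zero, Nat.cast_one, one_pow,
        show (4 : ℝ) = 2 * 2 from by norm_num]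
      field_simp
      ring
  · obtain ⟨j, rfl⟩ := hl
    have h := (hlim (m := 2) (S := Multiset.replicate (2 * j + 1) 1 + Multiset.replicate k 2)
      one_le_two (fun x hx => by
        rcases Multiset.mem_add.1 hx with hx | hx <;> rw [Multiset.eq_of_mem_replicate hx]
        norm_num)
      (by simp [Multiset.replicate_succ]) (by simp; grind)).const_mul
      ((1 / 4 : ℝ) ^ (2 * j + 1) * (-1 / 16) ^ (k + 1))
    simp only [Multiset.card_add, Multiset.card_replicate, Multiset.prod_add,
      Multiset.prod_replicate] at h
    convert h using 1
    · funext n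
      rw [kappaJ_succ_succ hβ0 hα hδ]
      ring_nf
    · congr 1
      have hs : (-1 : ℝ) ^ (k + 1) * (-1) ^ (2 * j + 1 + k) = 1 := by
        rw [← pow_add]; exact Even.neg_one_pow (by grind)
      rw [oddConst, show k + 1 + (2 * j + 1) - 1 = 2 * j + 1 + k from by omega, neg_pow (2 / β),
        neg_div, neg_pow (1 / 16 : ℝ)]
      generalize (-1 : ℝ) ^ (k + 1) = x at hs ⊢
      rw [eq_inv_of_mul_eq_one_right hs]
      have hx : x ≠ 0 := left_ne_zero_of_mul_eq_one hs
      push_cast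
      simp only [div_pow, mul_pow, pow_succ, pow_zero, pow_add, one_pow,
        show (4 : ℝ) = 2 * 2 from by norm_num, show (16 : ℝ) = 2 * 2 * 2 * 2 from by norm_num]
      field_simp
      ring
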